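/- arXiv:2105.14611 — 8 statements merged into one kernel-verified Lean document; each statement's English description precedes it below -/
import Mathlib

section
/- Let N ≥ 2 and let x_1, …, x_N ∈ ℝ^d be arbitrary vectors. Fix indices i ≠ k in {1,…,N}, and let η^i_j ≥ 0 (for j ≠ i) and η^k_j ≥ 0 (for j ≠ k) satisfy Σ_{j ≠ i} η^i_j = 1 and Σ_{j ≠ k} η^k_j = 1. Set μ := min{ min_{j ≠ i} η^i_j , min_{j ≠ k} η^k_j } ≥ 0. Then |Σ_{j ≠ i} η^i_j x_j − Σ_{j ≠ k} η^k_j x_j| ≤ (1 − (N−2)μ) · max_{p,q ∈ {1,…,N}} |x_p − x_q|, where |·| is the Euclidean norm on ℝ^d. -/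
open Finset

/-- Two nonnegative combinations of the same points with the same total weight `s` differ by at most
`s` times any bound on the pairwise distances. -/
theorem norm_sum_smul_sub_sum_smul_le {ι E : Type*} [Fintype ι] [SeminormedAddCommGroup E]
    [NormedSpace ℝ E] {a b : ι → ℝ} {x : ι → E} {s D : ℝ} (ha : ∀ j, 0 ≤ a j) (hb : ∀ j, 0 ≤ b j)
    (has : ∑ j, a j = s) (hbs : ∑ j, b j = s) (hD : ∀ p q, ‖x p - x q‖ ≤ D) :
    ‖∑ j, a j • x j - ∑ j, b j • x j‖ ≤ s * D := by
  have hs : 0 ≤ s := has ▸ Finset.sum_nonneg fun j _ => ha j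
  rcases hs.eq_or_lt with rfl | hs
  · have ha0 : ∀ j, a j = 0 := by
      simpa using (Finset.sum_eq_zero_iff_of_nonneg fun j _ => ha j).1 has
    have hb0 : ∀ j, b j = 0 := by
      simpa using (Finset.sum_eq_zero_iff_of_nonneg fun j _ => hb j).1 hbs
    simp [ha0, hb0]
  · have key : s • (∑ j, a j • x j - ∑ j, b j • x j) =
        ∑ p, ∑ q, (a p * b q) • (x p - x q) := by
      simp only [smul_sub, Finset.sum_sub_distrib]
      congr 1
      · simp only [← Finset.sum_smul, ← Finset.mul_sum, hbs, Finset.smul_sum, smul_smul, mul_comm]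
      · rw [Finset.sum_comm]
        simp only [← Finset.sum_smul, ← Finset.sum_mul, has, Finset.smul_sum, smul_smul]
    refine le_of_mul_le_mul_left ?_ hs
    calc s * ‖∑ j, a j • x j - ∑ j, b j • x j‖
        = ‖∑ p, ∑ q, (a p * b q) • (x p - x q)‖ := by
          rw [← key, norm_smul, Real.norm_of_nonneg hs.le]
      _ ≤ ∑ p, ∑ q, a p * b q * D := by
          refine norm_sum_le_of_le _ fun p _ => norm_sum_le_of_le _ fun q _ => ?_
          have hab := mul_nonneg (ha p) (hb q)
          rw [norm_smul, Real.norm_of_nonneg hab]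
          exact mul_le_mul_of_nonneg_left (hD p q) hab
      _ = s * (s * D) := by
          simp only [← Finset.sum_mul, ← Finset.mul_sum, has, hbs, mul_assoc]

/-- **Dobrushin's geometric lemma.** For `N ≥ 2` vectors in `ℝ^d`, two convex combinations
(avoiding indices `i` resp. `k`) differ by at most `(1 - (N-2)μ)` times the maximal
pairwise distance, where `μ` is the minimum of all involved weights. -/
theorem dobrushin_geometric_lemma {N d : ℕ} (hN : 2 ≤ N)
    (x : Fin N → EuclideanSpace ℝ (Fin d))
    (i k : Fin N) (hik : i ≠ k)
    (ηi ηk : Fin N → ℝ)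
    (hηi : ∀ j, j ≠ i → 0 ≤ ηi j) (hηk : ∀ j, j ≠ k → 0 ≤ ηk j)
    (hsumi : ∑ j ∈ Finset.univ.erase i, ηi j = 1)
    (hsumk : ∑ j ∈ Finset.univ.erase k, ηk j = 1)
    (μ : ℝ)
    (hμ : μ = min
      ((Finset.univ.erase i).inf'
        ⟨k, Finset.mem_erase.mpr ⟨hik.symm, Finset.mem_univ k⟩⟩ ηi)
      ((Finset.univ.erase k).inf'
        ⟨i, Finset.mem_erase.mpr ⟨hik, Finset.mem_univ i⟩⟩ ηk)) :
    ‖(∑ j ∈ Finset.univ.erase i, ηi j • x j) - ∑ j ∈ Finset.univ.erase k, ηk j • x j‖ ≤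
      (1 - ((N : ℝ) - 2) * μ) * ⨆ p : Fin N × Fin N, ‖x p.1 - x p.2‖ := by
  have hμi : ∀ j, j ≠ i → μ ≤ ηi j := fun j hj =>
    hμ.le.trans ((min_le_left _ _).trans (Finset.inf'_le _ (by simpa using hj)))
  have hμk : ∀ j, j ≠ k → μ ≤ ηk j := fun j hj =>
    hμ.le.trans ((min_le_right _ _).trans (Finset.inf'_le _ (by simpa using hj)))
  have erase_eq : ∀ {M : Type} [AddCommMonoid M] (l : Fin N) (f : Fin N → M),
      ∑ j ∈ Finset.univ.erase l, f j = ∑ j, if j = l then 0 else f j := by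
    intro M _ l f
    rw [← Finset.filter_ne', Finset.sum_filter]
    simp only [ne_eq, ite_not]
  set c : Fin N → ℝ := fun j => if j ∈ (Finset.univ.erase i).erase k then μ else 0 with hc
  have hcsum : ∑ j, c j = ((N : ℝ) - 2) * μ := by
    rw [hc, Finset.sum_ite_mem, Finset.univ_inter, Finset.sum_const,
      Finset.card_erase_of_mem (by simp [hik.symm]), Finset.card_erase_of_mem (Finset.mem_univ i),
      Finset.card_univ, Fintype.card_fin, Nat.sub_sub, nsmul_eq_mul, Nat.cast_sub hN]
    norm_num
  set a : Fin N → ℝ := fun j => (if j = i then 0 else ηi j) - c j with ha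
  set b : Fin N → ℝ := fun j => (if j = k then 0 else ηk j) - c j with hb
  have hdiff : (∑ j ∈ Finset.univ.erase i, ηi j • x j) - ∑ j ∈ Finset.univ.erase k, ηk j • x j =
      ∑ j, a j • x j - ∑ j, b j • x j := by
    simp only [erase_eq, ha, hb, sub_smul, Finset.sum_sub_distrib, ite_smul, zero_smul,
      sub_sub_sub_cancel_right]
  rw [hdiff]
  refine norm_sum_smul_sub_sum_smul_le (fun j => ?_) (fun j => ?_) ?_ ?_ fun p q => ?_
  · have := hμi j
    have := hηi j
    simp only [ha, hc, Finset.mem_erase, Finset.mem_univ]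
    grind
  · have := hμk j
    have := hηk j
    simp only [hb, hc, Finset.mem_erase, Finset.mem_univ]
    grind
  · rw [ha, Finset.sum_sub_distrib, ← erase_eq, hsumi, hcsum]
  · rw [hb, Finset.sum_sub_distrib, ← erase_eq, hsumk, hcsum]
  · exact le_ciSup (f := fun p : Fin N × Fin N => ‖x p.1 - x p.2‖)
      (Set.finite_range _).bddAbove (p, q)
end

section
/- Let N ≥ 3, let the weights ψ be row-stochastic and positive, and let x be a solution of the transmission-delay system. Assume there exist T_0 > 0 and fixed indices I, J ∈ {1,…,N} such that d_x(t) = |x_I(t) − x_J(t)| for all t ≥ T_0, and assume λτ ≤ 1. Then lim_{t→∞} d_x(t) = 0, i.e., all solutions converge to a consensus state. -/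
open Finset

/-- The maximum opinion discord `d_x(t) = max_{i,j} |x_i(t) - x_j(t)|`. -/
noncomputable def maxDiscord {N d : ℕ} (x : Fin N → ℝ → EuclideanSpace ℝ (Fin d)) (t : ℝ) : ℝ :=
  ⨆ p : Fin N × Fin N, ‖x p.1 t - x p.2 t‖

/-- A curve relaxing at unit rate towards a signal bounded by `B` is bounded by the corresponding
convex combination of its initial norm and `B`. -/
theorem norm_le_of_relaxation {E : Type*} [NormedAddCommGroup E] [NormedSpace ℝ E]
    {w v : ℝ → E} {a b B : ℝ} (hw : ContinuousOn w (Set.Icc a b))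
    (hd : ∀ t ∈ Set.Ico a b, HasDerivWithinAt w (v t - w t) (Set.Ici t) t)
    (hv : ∀ t ∈ Set.Ico a b, ‖v t‖ ≤ B) {t : ℝ} (ht : t ∈ Set.Icc a b) :
    ‖w t‖ ≤ Real.exp (-(t - a)) * ‖w a‖ + (1 - Real.exp (-(t - a))) * B := by
  have hexp : ∀ s : ℝ, HasDerivAt (fun s => Real.exp (s - a)) (Real.exp (s - a)) s := fun s => by
    simpa using ((hasDerivAt_id s).sub_const a).exp
  have key : ‖Real.exp (t - a) • w t‖ ≤ ‖w a‖ + B * (Real.exp (t - a) - 1) := by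
    refine image_norm_le_of_norm_deriv_right_le_deriv_boundary
      (f := fun s => Real.exp (s - a) • w s) (f' := fun s => Real.exp (s - a) • v s)
      (B := fun s => ‖w a‖ + B * (Real.exp (s - a) - 1)) (B' := fun s => B * Real.exp (s - a))
      (ContinuousOn.smul (by fun_prop) hw) (fun s hs => ?_) (by simp)
      (fun s => (((hexp s).sub_const 1).const_mul B).const_add _) (fun s hs => ?_) ht
    · convert (hexp s).hasDerivWithinAt.smul (hd s hs) using 1
      · rfl
      · rw [smul_sub]
        abel
    · rw [norm_smul, Real.norm_eq_abs, abs_of_pos (Real.exp_pos _), mul_comm]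
      exact mul_le_mul_of_nonneg_right (hv s hs) (Real.exp_pos _).le
  rw [norm_smul, Real.norm_eq_abs, abs_of_pos (Real.exp_pos _)] at key
  have hmul : Real.exp (-(t - a)) * Real.exp (t - a) = 1 := by
    rw [← Real.exp_add]
    simp
  have := mul_le_mul_of_nonneg_left key (Real.exp_pos (-(t - a))).le
  linear_combination this + (B - ‖w t‖) * hmul

/-- Two averages of a family of diameter at most `K` whose weights overlap by at least `ε` at some
index are at distance at most `(1 - ε ^ 2) * K`. -/
theorem norm_sum_smul_sub_sum_smul_le_s1 {ι E : Type*} [Fintype ι] [NormedAddCommGroup E]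
    [NormedSpace ℝ E] {p q : ι → ℝ} (hp : ∀ i, 0 ≤ p i) (hq : ∀ i, 0 ≤ q i)
    (hp1 : ∑ i, p i = 1) (hq1 : ∑ i, q i = 1) {m : ι} {ε : ℝ} (hε : 0 ≤ ε) (hpm : ε ≤ p m)
    (hqm : ε ≤ q m) {y : ι → E} {K : ℝ} (hy : ∀ i j, ‖y i - y j‖ ≤ K) :
    ‖∑ i, p i • y i - ∑ i, q i • y i‖ ≤ (1 - ε ^ 2) * K := by
  classical
  have hK : 0 ≤ K := (norm_nonneg _).trans (hy m m)
  have h1 : ∑ i, p i • y i - ∑ i, q i • y i = ∑ i, ∑ j, (p i * q j) • (y i - y j) := by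
    have hl : ∑ i, ∑ j, (p i * q j) • y i = ∑ i, p i • y i := by
      simp_rw [← Finset.sum_smul, ← Finset.mul_sum, hq1, mul_one]
    have hr : ∑ i, ∑ j, (p i * q j) • y j = ∑ i, q i • y i := by
      rw [Finset.sum_comm]
      simp_rw [← Finset.sum_smul, ← Finset.sum_mul, hp1, one_mul]
    simp_rw [smul_sub, Finset.sum_sub_distrib, hl, hr]
  have hterm : ∀ i j, ‖(p i * q j) • (y i - y j)‖ ≤
      p i * q j * K - if i = m then (if j = m then ε ^ 2 * K else 0) else 0 := by
    intro i j
    have hpq := mul_nonneg (hp i) (hq j)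
    rw [norm_smul, Real.norm_eq_abs, abs_of_nonneg hpq]
    split_ifs with hi hj
    · subst hi hj
      have : ε ^ 2 ≤ p j * q j := by nlinarith
      simpa using mul_le_mul_of_nonneg_right this hK
    all_goals
      rw [sub_zero]
      exact mul_le_mul_of_nonneg_left (hy i j) hpq
  rw [h1]
  refine (norm_sum_le_of_le _ fun i _ => norm_sum_le_of_le _ fun j _ => hterm i j).trans_eq ?_
  simp_rw [Finset.sum_sub_distrib, ← Finset.sum_mul, ← Finset.mul_sum, hq1, mul_one, hp1]
  simp [Finset.sum_ite_eq']
  ring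

/-- A relaxation system `wᵢ' = vᵢ - wᵢ` whose signals satisfy a strict delayed contraction estimate
with respect to the joint bound of `w` and `v` decays to zero, uniformly over the index set. -/
theorem eventually_norm_lt_of_relaxation_of_contraction {ι E : Type*} [Finite ι]
    [NormedAddCommGroup E] [NormedSpace ℝ E] {w v : ι → ℝ → E} {τ δ : ℝ} (hτ : 0 < τ)
    (hδ0 : 0 < δ) (hδ1 : δ ≤ 1) (hw : ∀ i, ContinuousOn (w i) (Set.Ici (-τ)))
    (hv : ∀ i, ContinuousOn (v i) (Set.Ici (-τ)))
    (hd : ∀ i, ∀ t ≥ (0 : ℝ), HasDerivWithinAt (w i) (v i t - w i t) (Set.Ici t) t)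
    (hvw : ∀ t > (0 : ℝ), ∀ K : ℝ, (∀ i, ‖w i (t - τ)‖ ≤ K ∧ ‖v i (t - τ)‖ ≤ K) →
      ∀ i, ‖v i t‖ ≤ (1 - δ) * K) {e : ℝ} (he : 0 < e) :
    ∀ᶠ t in Filter.atTop, ∀ i, ‖w i t‖ < e := by
  obtain ⟨K, hK0, hK⟩ : ∃ K : ℝ, 0 ≤ K ∧ ∀ i, ∀ t ∈ Set.Icc (-τ) 0, ‖w i t‖ ≤ K ∧ ‖v i t‖ ≤ K := by
    have hbdd : ∀ i, ∃ C : ℝ, ∀ t ∈ Set.Icc (-τ) 0, ‖w i t‖ ≤ C ∧ ‖v i t‖ ≤ C := fun i => by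
      obtain ⟨A, hA⟩ := isCompact_Icc.exists_bound_of_continuousOn
        ((hw i).mono Set.Icc_subset_Ici_self)
      obtain ⟨B, hB⟩ := isCompact_Icc.exists_bound_of_continuousOn
        ((hv i).mono Set.Icc_subset_Ici_self)
      exact ⟨max A B, fun t ht => ⟨(hA t ht).trans (le_max_left _ _),
        (hB t ht).trans (le_max_right _ _)⟩⟩
    choose C hC using hbdd
    obtain ⟨M, hM⟩ := (Set.finite_range C).bddAbove
    refine ⟨max M 0, le_max_right _ _, fun i t ht => ?_⟩
    have hCM : C i ≤ max M 0 := (hM ⟨i, rfl⟩).trans (le_max_left _ _)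
    exact ⟨(hC i t ht).1.trans hCM, (hC i t ht).2.trans hCM⟩
  have hrelax : ∀ {a b B : ℝ}, 0 ≤ a → ∀ i, (∀ t ∈ Set.Ico a b, ‖v i t‖ ≤ B) → ∀ t ∈ Set.Icc a b,
      ‖w i t‖ ≤ Real.exp (-(t - a)) * ‖w i a‖ + (1 - Real.exp (-(t - a))) * B :=
    fun ha i hB t ht => norm_le_of_relaxation
      ((hw i).mono fun s hs => (by linarith : -τ ≤ _).trans hs.1)
      (fun s hs => hd i s (ha.trans hs.1)) hB ht
  have hbound : ∀ n : ℕ, ∀ i, ∀ t ∈ Set.Icc (-τ) (n * τ), ‖w i t‖ ≤ K ∧ ‖v i t‖ ≤ K := by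
    intro n
    induction n with
    | zero => simpa using hK
    | succ n ih =>
      have hv' : ∀ i, ∀ t ∈ Set.Icc 0 ((n + 1 : ℕ) * τ), ‖v i t‖ ≤ K := by
        intro i t ht
        rcases ht.1.eq_or_lt with rfl | h0
        · exact (hK i 0 ⟨by linarith, le_rfl⟩).2
        · have h2 := ht.2
          push_cast at h2
          refine (hvw t h0 K (fun j => ih j _ ⟨by linarith, by linarith⟩) i).trans ?_
          nlinarith
      intro i t ht
      rcases le_total t 0 with h0 | h0
      · exact hK i t ⟨ht.1, h0⟩
      · refine ⟨?_, hv' i t ⟨h0, ht.2⟩⟩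
        have h1 := hrelax le_rfl i (fun s hs => hv' i s ⟨hs.1, hs.2.le⟩) t ⟨h0, ht.2⟩
        have h2 := mul_le_mul_of_nonneg_left (hK i 0 ⟨by linarith, le_rfl⟩).1
          (Real.exp_pos (-(t - 0))).le
        linarith
  have hdecay : ∀ k : ℕ, ∃ T : ℝ, 0 ≤ T ∧ ∀ i, ∀ t ≥ T,
      ‖w i t‖ ≤ K * (1 - δ / 2) ^ k ∧ ‖v i t‖ ≤ K * (1 - δ / 2) ^ k := by
    intro k
    induction k with
    | zero =>
      refine ⟨0, le_rfl, fun i t ht => ?_⟩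
      obtain ⟨n, hn⟩ := exists_nat_ge (t / τ)
      simpa using hbound n i t ⟨by linarith, (div_le_iff₀ hτ).1 hn⟩
    | succ k ih =>
      obtain ⟨T, hT0, hT⟩ := ih
      rw [pow_succ, ← mul_assoc]
      set M := K * (1 - δ / 2) ^ k
      have hM : 0 ≤ M := mul_nonneg hK0 (pow_nonneg (by linarith) k)
      have hv' : ∀ i, ∀ t ≥ T + τ, ‖v i t‖ ≤ (1 - δ) * M := fun i t ht =>
        hvw t (by linarith) M (fun j => hT j _ (by linarith)) i
      have hlim : Filter.Tendsto (fun t : ℝ => Real.exp (-(t - (T + τ)))) Filter.atTop (nhds 0) :=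
        Real.tendsto_exp_neg_atTop_nhds_zero.comp
          (Filter.tendsto_atTop_add_const_right _ (-(T + τ)) Filter.tendsto_id)
      obtain ⟨S, hS⟩ := Filter.eventually_atTop.1
        (hlim.eventually_le_const (show (0 : ℝ) < δ / 2 by linarith))
      refine ⟨max S (T + τ), (by linarith : 0 ≤ T + τ).trans (le_max_right _ _), fun i t ht => ?_⟩
      have htS := hS t ((le_max_left _ _).trans ht)
      have htT := (le_max_right _ _).trans ht
      refine ⟨?_, (hv' i t htT).trans ?_⟩
      · have h1 := hrelax (by linarith) i (fun s hs => hv' i s hs.1) t ⟨htT, le_rfl⟩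
        have h2 := mul_le_mul_of_nonneg_left (hT i (T + τ) (by linarith)).1
          (Real.exp_pos (-(t - (T + τ)))).le
        have h3 := mul_le_mul_of_nonneg_right htS hM
        have h4 := mul_nonneg (Real.exp_pos (-(t - (T + τ)))).le
          (mul_nonneg (sub_nonneg.2 hδ1) hM)
        linarith
      · nlinarith
  have hgeom : Filter.Tendsto (fun k : ℕ => K * (1 - δ / 2) ^ k) Filter.atTop (nhds 0) := by
    simpa using (tendsto_pow_atTop_nhds_zero_of_lt_one (by linarith : (0 : ℝ) ≤ 1 - δ / 2)
      (by linarith)).const_mul K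
  obtain ⟨k, hk⟩ := (hgeom.eventually_lt_const he).exists
  obtain ⟨T, -, hT⟩ := hdecay k
  filter_upwards [Filter.eventually_ge_atTop T] with t ht i
  exact (hT i t ht).1.trans_lt hk

/-- **Asymptotic consensus for the transmission-type delay system.**
If `N ≥ 3`, the weights are row-stochastic and positive, the maximal discord is eventually
realized by a fixed pair of indices, and `λτ ≤ 1`, then the solution converges to consensus. -/
theorem transmission_delay_consensus {N d : ℕ} (hN : 3 ≤ N) (hd : 1 ≤ d)
    (τ lam : ℝ) (hτ : 0 < τ) (hlam : 0 ≤ lam) (hlamτ : lam * τ ≤ 1)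
    (ψ : Fin N → Fin N → ℝ)
    (hψpos : ∀ i j : Fin N, i ≠ j → 0 < ψ i j)
    (hψstoch : ∀ i : Fin N, ∑ j ∈ Finset.univ.erase i, ψ i j = 1)
    (x xd : Fin N → ℝ → EuclideanSpace ℝ (Fin d))
    (hderiv : ∀ i, ∀ t ∈ Set.Ici (-τ), HasDerivWithinAt (x i) (xd i t) (Set.Ici (-τ)) t)
    (hcont : ∀ i, ContinuousOn (xd i) (Set.Ici (-τ)))
    (hode : ∀ t > (0 : ℝ), ∀ i, xd i t =
      ∑ j ∈ Finset.univ.erase i, ψ i j • (x j (t - τ) + (lam * τ) • xd j (t - τ) - x i t))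
    (T0 : ℝ) (hT0 : 0 < T0) (I J : Fin N)
    (hIJ : ∀ t ≥ T0, maxDiscord x t = ‖x I t - x J t‖) :
    Filter.Tendsto (maxDiscord x) Filter.atTop (nhds 0) := by
  classical
  have : Nonempty (Fin N) := ⟨⟨0, by omega⟩⟩
  set Ψ : Fin N → Fin N → ℝ := fun i j => if j = i then 0 else ψ i j with hΨ
  have hΨ0 : ∀ i j, 0 ≤ Ψ i j := fun i j => by
    by_cases h : j = i
    · simp [hΨ, h]
    · simpa [hΨ, h] using (hψpos i j (Ne.symm h)).le
  have hΨsum : ∀ {M : Type} [AddCommGroup M] [Module ℝ M] (i : Fin N) (f : Fin N → M),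
      ∑ j ∈ Finset.univ.erase i, ψ i j • f j = ∑ j, Ψ i j • f j := by
    intro M _ _ i f
    rw [← Finset.sum_erase Finset.univ (a := i) (f := fun j => Ψ i j • f j) (by simp [hΨ])]
    refine Finset.sum_congr rfl fun j hj => ?_
    simp [hΨ, Finset.ne_of_mem_erase hj]
  have hΨ1 : ∀ i, ∑ j, Ψ i j = 1 := fun i => by
    simpa [hψstoch i] using (hΨsum i fun _ => (1 : ℝ)).symm
  obtain ⟨ε, hε0, hε1, hε⟩ : ∃ ε : ℝ, 0 < ε ∧ ε ≤ 1 ∧ ∀ i j, i ≠ j → ε ≤ ψ i j := by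
    obtain ⟨p, hp⟩ := Finite.exists_min
      fun p : Fin N × Fin N => if p.1 = p.2 then (1 : ℝ) else min 1 (ψ p.1 p.2)
    refine ⟨_, ?_, ?_, fun i j hij => (hp (i, j)).trans ?_⟩
    · split_ifs with h
      · exact one_pos
      · exact lt_min one_pos (hψpos _ _ h)
    · split_ifs
      · exact le_rfl
      · exact min_le_left _ _
    · simp [hij]
  have hthird : ∀ i k : Fin N, ∃ m, i ≠ m ∧ k ≠ m := fun i k => by
    obtain ⟨m, hm⟩ := Finset.exists_mem_notMem_of_card_lt_card (s := {i, k}) (t := Finset.univ)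
      ((Finset.card_le_two).trans_lt (by rw [Finset.card_univ, Fintype.card_fin]; omega))
    exact ⟨m, by rintro rfl; simp at hm, by rintro rfl; simp at hm⟩
  have hode' : ∀ t > (0 : ℝ), ∀ i, x i t + xd i t =
      ∑ j, Ψ i j • (x j (t - τ) + (lam * τ) • xd j (t - τ)) := fun t ht i => by
    rw [hode t ht i, hΨsum]
    simp_rw [smul_sub (Ψ i _) _ (x i t), Finset.sum_sub_distrib]
    rw [← Finset.sum_smul, hΨ1, one_smul]
    abel
  have hxcont : ∀ i, ContinuousOn (x i) (Set.Ici (-τ)) :=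
    fun i t ht => (hderiv i t ht).continuousWithinAt
  have hconsensus : ∀ e > (0 : ℝ), ∀ᶠ t in Filter.atTop,
      ∀ p : Fin N × Fin N, ‖x p.1 t - x p.2 t‖ < e := by
    intro e he
    refine eventually_norm_lt_of_relaxation_of_contraction
      (w := fun (p : Fin N × Fin N) t => x p.1 t - x p.2 t)
      (v := fun p t => (x p.1 t + xd p.1 t) - (x p.2 t + xd p.2 t)) (δ := ε ^ 2) hτ (by positivity)
      (pow_le_one₀ hε0.le hε1) (fun p => (hxcont _).sub (hxcont _))
      (fun p => ((hxcont _).add (hcont _)).sub ((hxcont _).add (hcont _)))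
      (fun p t ht => ?_) (fun t ht K hK p => ?_) he
    · have hsub : Set.Ici t ⊆ Set.Ici (-τ) := Set.Ici_subset_Ici.2 (by linarith)
      have ht' : t ∈ Set.Ici (-τ) := hsub Set.self_mem_Ici
      convert ((hderiv p.1 t ht').mono hsub).sub ((hderiv p.2 t ht').mono hsub) using 1
      · rfl
      · abel
    · obtain ⟨m, hm1, hm2⟩ := hthird p.1 p.2
      simp only [hode' t ht]
      refine norm_sum_smul_sub_sum_smul_le_s1 (m := m) (hΨ0 _) (hΨ0 _) (hΨ1 _) (hΨ1 _) hε0.le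
        (by simpa [hΨ, hm1.symm] using hε _ _ hm1) (by simpa [hΨ, hm2.symm] using hε _ _ hm2)
        fun i j => ?_
      obtain ⟨hw, hv⟩ := hK (i, j)
      have hsplit : x i (t - τ) + (lam * τ) • xd i (t - τ)
            - (x j (t - τ) + (lam * τ) • xd j (t - τ)) =
          (1 - lam * τ) • (x i (t - τ) - x j (t - τ)) + (lam * τ) •
            ((x i (t - τ) + xd i (t - τ)) - (x j (t - τ) + xd j (t - τ))) := by
        module
      have hL : 0 ≤ lam * τ := mul_nonneg hlam hτ.le
      rw [hsplit]
      refine (norm_add_le _ _).trans ?_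
      rw [norm_smul, norm_smul, Real.norm_of_nonneg hL, Real.norm_of_nonneg (sub_nonneg.2 hlamτ)]
      have h1 := mul_le_mul_of_nonneg_left hw (sub_nonneg.2 hlamτ)
      have h2 := mul_le_mul_of_nonneg_left hv hL
      linarith
  rw [Metric.tendsto_nhds]
  intro e he
  filter_upwards [hconsensus (e / 2) (half_pos he)] with t ht
  rw [Real.dist_0_eq_abs, maxDiscord, abs_of_nonneg (Real.iSup_nonneg fun _ => norm_nonneg _)]
  exact (ciSup_le fun p => (ht p).le).trans_lt (half_lt_self he)
end

section
/- Let the weights ψ be symmetric (ψ_{ij} = ψ_{ji}), bi-stochastic and irreducible, and assume (1 + λ)τ < 1/2. Then every solution x of the reaction-delay system converges to the consensus state given by the initial mean: lim_{t→∞} x_i(t) = X(0) for every i ∈ {1,…,N}, where X(0) := (1/N) Σ_{j=1}^N x_j(0). -/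
open Finset

/-- `ψ` is irreducible: for every `i ≠ j` there is a finite chain of positive weights
connecting `i` to `j`. -/
def IrreducibleWeights {N : ℕ} (ψ : Fin N → Fin N → ℝ) : Prop :=
  ∀ i j : Fin N, i ≠ j → ∃ (m : ℕ) (k : Fin (m + 1) → Fin N),
    k 0 = i ∧ k (Fin.last m) = j ∧ ∀ l : Fin m, 0 < ψ (k l.castSucc) (k l.succ)

/-- A function dominated by a contraction of its delayed value plus a constant is bounded. -/
lemma exists_abs_le_of_delay_bound {g : ℝ → ℝ} {τ c B : ℝ} (hτ : 0 < τ) (hc : 0 ≤ c)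
    (hc1 : c < 1) (hg : ContinuousOn g (Set.Ici (-τ)))
    (h : ∀ t > 0, |g t| ≤ B + c * |g (t - τ)|) :
    ∃ M, ∀ t, -τ ≤ t → |g t| ≤ M := by
  obtain ⟨C, hC⟩ := isCompact_Icc.exists_bound_of_continuousOn
    (hg.mono (Set.Icc_subset_Ici_self : Set.Icc (-τ) 0 ⊆ _))
  have hstep : ∀ n : ℕ, ∀ t, -τ ≤ t → t ≤ n * τ → |g t| ≤ max C (B / (1 - c)) := by
    intro n
    induction n with
    | zero =>
      intro t ht ht'
      exact (hC t ⟨ht, by simpa using ht'⟩).trans (le_max_left _ _)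
    | succ n ih =>
      intro t ht ht'
      rcases le_or_gt t 0 with h0 | h0
      · exact (hC t ⟨ht, h0⟩).trans (le_max_left _ _)
      · have h1 := ih (t - τ) (by linarith) (by push_cast at ht'; linarith)
        have h2 : B ≤ max C (B / (1 - c)) * (1 - c) :=
          (div_le_iff₀ (by linarith)).1 (le_max_right _ _)
        nlinarith [h t h0, mul_le_mul_of_nonneg_left h1 hc]
  refine ⟨max C (B / (1 - c)), fun t ht => ?_⟩
  obtain ⟨n, hn⟩ := exists_nat_ge (t / τ)
  exact hstep n t ht ((div_le_iff₀ hτ).1 hn)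

/-- Young's inequality for the integral of `u` over a delay window, in terms of antiderivatives
`P` of `u` and `Q` of `u ^ 2`. -/
lemma two_mul_mul_sub_le_of_antideriv {u P Q : ℝ → ℝ} {τ : ℝ} (hτ : 0 ≤ τ)
    (hP : ∀ t, HasDerivAt P (u t) t) (hQ : ∀ t, HasDerivAt Q (u t ^ 2) t) (a t : ℝ) :
    2 * a * (P t - P (t - τ)) ≤ τ * a ^ 2 + (Q t - Q (t - τ)) := by
  have hmono : Monotone fun s => Q s - 2 * a * P s + s * a ^ 2 := by
    refine monotone_of_hasDerivAt_nonneg (f' := fun s => u s ^ 2 - 2 * a * u s + 1 * a ^ 2)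
      (fun s => ((hQ s).sub ((hP s).const_mul (2 * a))).add
        ((hasDerivAt_id s).mul_const (a ^ 2))) fun s => ?_
    change 0 ≤ u s ^ 2 - 2 * a * u s + 1 * a ^ 2
    nlinarith [sq_nonneg (u s - a)]
  have := hmono (show t - τ ≤ t by linarith)
  simp only at this
  nlinarith

/-- The increment of an antiderivative `R` of a monotone `Q` is controlled by the right end
value of `Q`. -/
lemma sub_le_mul_of_antideriv_monotone {Q R : ℝ → ℝ} {τ : ℝ} (hτ : 0 ≤ τ) (hQ : Monotone Q)
    (hR : ∀ t, HasDerivAt R (Q t) t) (t : ℝ) : R t - R (t - τ) ≤ τ * Q t := by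
  have hd : Differentiable ℝ R := fun s => (hR s).differentiableAt
  have := (convex_Icc (t - τ) t).image_sub_le_mul_sub_of_deriv_le (C := Q t)
    hd.continuous.continuousOn hd.differentiableOn
    (fun s hs => by rw [(hR s).deriv]; exact hQ (interior_subset hs).2)
    (t - τ) ⟨le_rfl, by linarith⟩ t ⟨by linarith, le_rfl⟩ (by linarith)
  linarith

/-- Barbalat-type criterion: a function with bounded derivative and bounded `L²` norm on a half
line vanishes at infinity. -/
lemma tendsto_zero_of_antideriv_sq_bounded {u ud Q : ℝ → ℝ} {K M Md : ℝ}
    (hu : ∀ t > 0, HasDerivAt u (ud t) t) (hud : ContinuousOn ud (Set.Ioi 0))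
    (hQ : ∀ t, HasDerivAt Q (u t ^ 2) t) (hK : ∀ t ≥ 0, Q t ≤ K)
    (hM : ∀ t > 0, |u t| ≤ M) (hMd : ∀ t > 0, |ud t| ≤ Md) :
    Filter.Tendsto u Filter.atTop (nhds 0) := by
  have hmono : Monotone Q := monotone_of_hasDerivAt_nonneg hQ fun t => sq_nonneg _
  have hlim : Filter.Tendsto Q Filter.atTop (nhds (⨆ t, Q t)) := by
    refine tendsto_atTop_ciSup hmono ⟨K, ?_⟩
    rintro _ ⟨t, rfl⟩
    exact (hmono (le_max_left t 0)).trans (hK _ (le_max_right t 0))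
  have hint : MeasureTheory.IntegrableOn (fun t => u t ^ 2) (Set.Ioi 0) :=
    MeasureTheory.integrableOn_Ioi_deriv_of_nonneg (hQ 0).continuousAt.continuousWithinAt
      (fun t _ => hQ t) (fun t _ => sq_nonneg _) hlim
  have hucont : ContinuousOn u (Set.Ioi 0) := fun t ht =>
    (hu t ht).continuousAt.continuousWithinAt
  have hcube : MeasureTheory.IntegrableOn (fun t => u t ^ 3) (Set.Ioi 0) := by
    refine (MeasureTheory.Integrable.bdd_mul (c := M) hint
      (hucont.aestronglyMeasurable measurableSet_Ioi)
      (MeasureTheory.ae_restrict_of_forall_mem measurableSet_Ioi hM)).congr ?_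
    exact Filter.Eventually.of_forall fun t => by ring
  have hcube' : MeasureTheory.IntegrableOn (fun t => 3 * u t ^ 2 * ud t) (Set.Ioi 0) := by
    refine ((MeasureTheory.Integrable.bdd_mul (c := Md) hint
      (hud.aestronglyMeasurable measurableSet_Ioi)
      (MeasureTheory.ae_restrict_of_forall_mem measurableSet_Ioi hMd)).const_mul 3).congr ?_
    exact Filter.Eventually.of_forall fun t => by ring
  have h3 : Filter.Tendsto (fun t => u t ^ 3) Filter.atTop (nhds 0) :=
    MeasureTheory.tendsto_zero_of_hasDerivAt_of_integrableOn_Ioi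
      (fun t ht => ((hu t ht).pow 3).congr_deriv (by norm_num)) hcube' hcube
  rw [Metric.tendsto_atTop] at h3 ⊢
  intro ε hε
  obtain ⟨T, hT⟩ := h3 (ε ^ 3) (by positivity)
  refine ⟨T, fun t ht => ?_⟩
  have := hT t ht
  rw [Real.dist_eq, sub_zero, abs_pow] at this
  rw [Real.dist_eq, sub_zero]
  exact lt_of_pow_lt_pow_left₀ 3 hε.le this

/-- The Lyapunov functional of the scalar delay equation `u' = -μ u(t - τ) - c u'(t - τ)`, up to
the correction `2 μ (1 - c - μ τ) Q`, is nonincreasing. Here `P`, `Q`, `R` are antiderivatives of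
`u`, `u ^ 2` and `Q`. -/
lemma antitoneOn_delay_lyapunov {u ud P Q R : ℝ → ℝ} {τ μ c : ℝ} (hτ : 0 < τ) (hμ : 0 ≤ μ)
    (hc : 0 ≤ c) (hucont : Continuous u)
    (hu : ∀ t > -τ, HasDerivAt u (ud t) t)
    (hode : ∀ t > 0, ud t = -(μ * u (t - τ) + c * ud (t - τ)))
    (hP : ∀ t, HasDerivAt P (u t) t) (hQ : ∀ t, HasDerivAt Q (u t ^ 2) t)
    (hR : ∀ t, HasDerivAt R (Q t) t) :
    AntitoneOn (fun t => (u t + c * u (t - τ) - μ * (P t - P (t - τ))) ^ 2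
      + μ * c * (Q t - Q (t - τ)) + μ ^ 2 * (τ * Q t - (R t - R (t - τ)))
      + 2 * μ * (1 - c - μ * τ) * Q t) (Set.Ici 0) := by
  have hPc : Continuous P := continuous_iff_continuousAt.2 fun t => (hP t).continuousAt
  have hQc : Continuous Q := continuous_iff_continuousAt.2 fun t => (hQ t).continuousAt
  have hRc : Continuous R := continuous_iff_continuousAt.2 fun t => (hR t).continuousAt
  refine antitoneOn_of_hasDerivWithinAt_nonpos (convex_Ici 0)
    (f' := fun t => 2 * (u t + c * u (t - τ) - μ * (P t - P (t - τ))) * (-μ * u t)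
      + μ * c * (u t ^ 2 - u (t - τ) ^ 2) + μ ^ 2 * (τ * u t ^ 2 - (Q t - Q (t - τ)))
      + 2 * μ * (1 - c - μ * τ) * u t ^ 2)
    (by fun_prop) ?_ ?_
  · intro t ht
    rw [interior_Ici] at ht
    have ht0 : (0 : ℝ) < t := ht
    have h1 := (hu t (by linarith)).add
      (((hu (t - τ) (by linarith)).comp_sub_const t τ).const_mul c)
    have h2 := ((hP t).sub ((hP (t - τ)).comp_sub_const t τ)).const_mul μ
    have h3 := ((hQ t).sub ((hQ (t - τ)).comp_sub_const t τ)).const_mul (μ * c)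
    have h4 := (((hQ t).const_mul τ).sub
      ((hR t).sub ((hR (t - τ)).comp_sub_const t τ))).const_mul (μ ^ 2)
    have h5 := (hQ t).const_mul (2 * μ * (1 - c - μ * τ))
    refine (((((h1.sub h2).pow 2).add h3).add h4).add h5).hasDerivWithinAt.congr_deriv ?_
    simp only [Pi.add_apply, Pi.sub_apply]
    rw [hode t ht0]
    push_cast
    ring
  · intro t _
    have h := two_mul_mul_sub_le_of_antideriv hτ.le hP hQ (u t) t
    have h1 := mul_le_mul_of_nonneg_left h (sq_nonneg μ)
    have h2 := mul_nonneg (mul_nonneg hμ hc) (sq_nonneg (u t + u (t - τ)))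
    nlinarith

/-- Decay for the scalar neutral delay equation `u' = -μ u(t - τ) - c u'(t - τ)` under the
smallness condition `c + μ τ < 1`. -/
lemma tendsto_zero_of_neutral_delay {u ud : ℝ → ℝ} {τ μ c : ℝ} (hτ : 0 < τ) (hμ : 0 < μ)
    (hc : 0 ≤ c) (hsmall : c + μ * τ < 1) (hucont : Continuous u)
    (hu : ∀ t > -τ, HasDerivAt u (ud t) t) (hud : ContinuousOn ud (Set.Ici (-τ)))
    (hode : ∀ t > 0, ud t = -(μ * u (t - τ) + c * ud (t - τ))) :
    Filter.Tendsto u Filter.atTop (nhds 0) := by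
  have key : ∀ f : ℝ → ℝ, Continuous f → ∃ F : ℝ → ℝ, ∀ t, HasDerivAt F (f t) t :=
    fun f hf => ⟨fun t => ∫ s in (0 : ℝ)..t, f s, fun t =>
      (hf.integral_hasStrictDerivAt 0 t).hasDerivAt⟩
  obtain ⟨P, hP⟩ := key u hucont
  obtain ⟨Q, hQ⟩ := key (fun t => u t ^ 2) (hucont.pow 2)
  obtain ⟨R, hR⟩ := key Q (continuous_iff_continuousAt.2 fun t => (hQ t).continuousAt)
  have hmono : Monotone Q := monotone_of_hasDerivAt_nonneg hQ fun t => sq_nonneg _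
  have hanti := antitoneOn_delay_lyapunov hτ hμ.le hc hucont hu hode hP hQ hR
  set κ := 2 * μ * (1 - c - μ * τ)
  have hκpos : 0 < κ := mul_pos (by linarith) (by linarith)
  obtain ⟨E, hE⟩ : ∃ E, ∀ t ≥ 0,
      (u t + c * u (t - τ) - μ * (P t - P (t - τ))) ^ 2 + κ * Q t ≤ E := by
    refine ⟨_, fun t ht => le_trans ?_ (hanti (Set.mem_Ici.2 le_rfl) ht ht)⟩
    have h1 := mul_nonneg (mul_nonneg hμ.le hc)
      (sub_nonneg.2 (hmono (show t - τ ≤ t by linarith)))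
    have h2 := mul_nonneg (sq_nonneg μ)
      (sub_nonneg.2 (sub_le_mul_of_antideriv_monotone hτ.le hmono hR t))
    simp only
    linarith
  have hK : ∀ t ≥ 0, Q t ≤ E / κ := fun t ht => by
    rw [le_div_iff₀ hκpos]
    nlinarith [hE t ht, sq_nonneg (u t + c * u (t - τ) - μ * (P t - P (t - τ)))]
  set B := (E / κ - Q (-τ) + τ) / 2 with hB
  have hPb : ∀ t ≥ 0, |P t - P (t - τ)| ≤ B := fun t ht => by
    have h1 := two_mul_mul_sub_le_of_antideriv hτ.le hP hQ 1 t
    have h2 := two_mul_mul_sub_le_of_antideriv hτ.le hP hQ (-1) t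
    have h3 := hK t ht
    have h4 := hmono (show -τ ≤ t - τ by linarith)
    rw [abs_le]
    constructor <;> linarith
  have hDb : ∀ t ≥ 0, |u t + c * u (t - τ) - μ * (P t - P (t - τ))| ≤ E - κ * Q 0 + 1 :=
    fun t ht => by
    have h1 := hE t ht
    have h2 := mul_le_mul_of_nonneg_left (hmono ht) hκpos.le
    rw [← sq_abs] at h1
    nlinarith [sq_nonneg (|u t + c * u (t - τ) - μ * (P t - P (t - τ))| - 1),
      abs_nonneg (u t + c * u (t - τ) - μ * (P t - P (t - τ)))]
  have hc1 : c < 1 := by nlinarith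
  obtain ⟨M, hM⟩ := exists_abs_le_of_delay_bound (B := E - κ * Q 0 + 1 + μ * B) hτ hc hc1
    hucont.continuousOn fun t ht => by
      have h1 := hDb t (le_of_lt ht)
      have h2 := mul_le_mul_of_nonneg_left (hPb t (le_of_lt ht)) hμ.le
      calc |u t| = |(u t + c * u (t - τ) - μ * (P t - P (t - τ)))
              + μ * (P t - P (t - τ)) - c * u (t - τ)| := by ring_nf
        _ ≤ |u t + c * u (t - τ) - μ * (P t - P (t - τ))|
              + |μ * (P t - P (t - τ))| + |c * u (t - τ)| :=
            (abs_sub _ _).trans (by gcongr; exact abs_add_le _ _)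
        _ ≤ _ := by
            rw [abs_mul μ, abs_mul c, abs_of_pos hμ, abs_of_nonneg hc]
            linarith
  obtain ⟨Md, hMd⟩ := exists_abs_le_of_delay_bound (B := μ * M) hτ hc hc1 hud fun t ht => by
    have ht0 : (0 : ℝ) < t := ht
    rw [hode t ht, abs_neg]
    refine (abs_add_le _ _).trans ?_
    rw [abs_mul μ, abs_mul c, abs_of_pos hμ, abs_of_nonneg hc]
    gcongr
    exact hM _ (by linarith)
  have hneg : ∀ t > (0 : ℝ), -τ < t := fun t ht => by linarith [show (0 : ℝ) < t from ht]
  exact tendsto_zero_of_antideriv_sq_bounded (fun t ht => hu t (hneg t ht))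
    (hud.mono fun t ht => (hneg t ht).le) hQ hK (fun t ht => hM t (hneg t ht).le)
    fun t ht => hMd t (hneg t ht).le

/-- The quadratic form `∑ ψ i j (v i + s v j) ^ 2` of symmetric stochastic weights on an
eigenvector `v`. -/
lemma sum_weights_mul_add_sq {ι : Type*} [Fintype ι] {ψ : ι → ι → ℝ} {v : ι → ℝ} {ν : ℝ}
    (hsymm : ∀ i j, ψ i j = ψ j i) (hstoch : ∀ i, ∑ j, ψ i j = 1)
    (hv : ∀ i, ∑ j, ψ i j * v j = ν * v i) (s : ℝ) :
    ∑ i, ∑ j, ψ i j * (v i + s * v j) ^ 2 = (1 + s ^ 2 + 2 * s * ν) * ∑ i, v i ^ 2 := by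
  have h1 : ∑ i, ∑ j, ψ i j * v i ^ 2 = ∑ i, v i ^ 2 := by
    simp_rw [← Finset.sum_mul, hstoch, one_mul]
  have h2 : ∑ i, ∑ j, ψ i j * v j ^ 2 = ∑ i, v i ^ 2 := by
    rw [Finset.sum_comm]
    simp_rw [fun i j => hsymm j i, ← Finset.sum_mul, hstoch, one_mul]
  have h3 : ∑ i, ∑ j, v i * (ψ i j * v j) = ν * ∑ i, v i ^ 2 := by
    simp_rw [← Finset.mul_sum, hv]
    rw [Finset.mul_sum]
    exact Finset.sum_congr rfl fun i _ => by ring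
  calc ∑ i, ∑ j, ψ i j * (v i + s * v j) ^ 2
      = ∑ i, ∑ j, ψ i j * v i ^ 2 + s ^ 2 * ∑ i, ∑ j, ψ i j * v j ^ 2
          + 2 * s * ∑ i, ∑ j, v i * (ψ i j * v j) := by
        simp_rw [Finset.mul_sum, ← Finset.sum_add_distrib]
        exact Finset.sum_congr rfl fun i _ => Finset.sum_congr rfl fun j _ => by ring
    _ = _ := by rw [h1, h2, h3]; ring

/-- Eigenvalues of symmetric bi-stochastic weights lie in `[-1, 1]`. -/
lemma abs_eigenvalue_weights_le_one {ι : Type*} [Fintype ι] {ψ : ι → ι → ℝ} {v : ι → ℝ} {ν : ℝ}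
    (hsymm : ∀ i j, ψ i j = ψ j i) (hnonneg : ∀ i j, 0 ≤ ψ i j) (hstoch : ∀ i, ∑ j, ψ i j = 1)
    (hv : ∀ i, ∑ j, ψ i j * v j = ν * v i) (hv0 : 0 < ∑ i, v i ^ 2) : |ν| ≤ 1 := by
  have h : ∀ s : ℝ, 0 ≤ 1 + s ^ 2 + 2 * s * ν := fun s => by
    refine nonneg_of_mul_nonneg_left ?_ hv0
    rw [← sum_weights_mul_add_sq hsymm hstoch hv s]
    exact Finset.sum_nonneg fun i _ => Finset.sum_nonneg fun j _ =>
      mul_nonneg (hnonneg i j) (sq_nonneg _)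
  have h1 := h 1
  have h2 := h (-1)
  rw [abs_le]
  constructor <;> linarith

/-- Fixed vectors of irreducible symmetric bi-stochastic weights are constant. -/
lemma eq_of_weights_fixed {N : ℕ} {ψ : Fin N → Fin N → ℝ} {v : Fin N → ℝ}
    (hsymm : ∀ i j, ψ i j = ψ j i) (hnonneg : ∀ i j, 0 ≤ ψ i j) (hstoch : ∀ i, ∑ j, ψ i j = 1)
    (hirr : IrreducibleWeights ψ) (hv : ∀ i, ∑ j, ψ i j * v j = v i) (i j : Fin N) :
    v i = v j := by
  have hsum : ∑ i, ∑ j, ψ i j * (v i + -1 * v j) ^ 2 = 0 := by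
    rw [sum_weights_mul_add_sq (ν := 1) hsymm hstoch (by simpa using hv)]
    ring
  have hterm : ∀ i j, 0 ≤ ψ i j * (v i + -1 * v j) ^ 2 := fun i j =>
    mul_nonneg (hnonneg i j) (sq_nonneg _)
  have hedge : ∀ i j, 0 < ψ i j → v i = v j := fun i j hij => by
    have h1 := (Finset.sum_eq_zero_iff_of_nonneg fun i _ =>
      Finset.sum_nonneg fun j _ => hterm i j).1 hsum i (Finset.mem_univ i)
    have h2 := (Finset.sum_eq_zero_iff_of_nonneg fun j _ => hterm i j).1 h1 j (Finset.mem_univ j)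
    have h3 := pow_eq_zero_iff two_ne_zero |>.1 ((mul_eq_zero.1 h2).resolve_left hij.ne')
    linarith
  by_cases hij : i = j
  · rw [hij]
  obtain ⟨m, k, h0, hm, hk⟩ := hirr i j hij
  have hchain : ∀ l : Fin (m + 1), v (k l) = v i := by
    intro l
    induction l using Fin.induction with
    | zero => rw [h0]
    | succ l ih => rw [← ih, hedge _ _ (hk l)]
  rw [← hchain (Fin.last m), hm]

/-- Projecting the reaction-delay system on an eigenvector of the weights gives a scalar delay
equation. -/
lemma reaction_delay_projection {ι : Type*} [Fintype ι] {ψ : ι → ι → ℝ} {v : ι → ℝ} {ν : ℝ}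
    (hsymm : ∀ i j, ψ i j = ψ j i) (hstoch : ∀ i, ∑ j, ψ i j = 1)
    (hv : ∀ i, ∑ j, ψ i j * v j = ν * v i) {X Xd : ι → ℝ} {z : ι → ℝ} {a : ℝ}
    (hz : ∀ i, z i = ∑ j, ψ i j * (X j + a * Xd j - X i - a * Xd i)) :
    ∑ i, v i * z i = -((1 - ν) * ∑ i, v i * X i + (1 - ν) * a * ∑ i, v i * Xd i) := by
  have h1 : ∑ i, ∑ j, v i * (ψ i j * (X j + a * Xd j)) = ν * ∑ i, v i * (X i + a * Xd i) := by
    rw [Finset.sum_comm, Finset.mul_sum]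
    refine Finset.sum_congr rfl fun j _ => ?_
    rw [← mul_assoc, ← hv, Finset.sum_mul]
    exact Finset.sum_congr rfl fun i _ => by rw [hsymm j i]; ring
  have h2 : ∑ i, ∑ j, v i * (ψ i j * (X i + a * Xd i)) = ∑ i, v i * (X i + a * Xd i) := by
    simp_rw [← Finset.mul_sum, ← Finset.sum_mul, hstoch, one_mul]
  have h3 : ∑ i, v i * (X i + a * Xd i) = ∑ i, v i * X i + a * ∑ i, v i * Xd i := by
    rw [Finset.mul_sum, ← Finset.sum_add_distrib]
    exact Finset.sum_congr rfl fun i _ => by ring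
  calc ∑ i, v i * z i
      = ∑ i, ∑ j, v i * (ψ i j * (X j + a * Xd j))
          - ∑ i, ∑ j, v i * (ψ i j * (X i + a * Xd i)) := by
        simp_rw [hz, Finset.mul_sum, ← Finset.sum_sub_distrib]
        exact Finset.sum_congr rfl fun i _ => Finset.sum_congr rfl fun j _ => by ring
    _ = _ := by rw [h1, h2, h3]; ring

/-- A continuous function with vanishing derivative on `(0, ∞)` is constant on `[0, ∞)`. -/
lemma eq_apply_zero_of_hasDerivAt_zero {u : ℝ → ℝ} (hu : Continuous u)
    (hd : ∀ t > 0, HasDerivAt u 0 t) {t : ℝ} (ht : 0 ≤ t) : u t = u 0 := by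
  have hd' : ∀ s ∈ interior (Set.Ici (0 : ℝ)),
      HasDerivWithinAt u 0 (interior (Set.Ici 0)) s := fun s hs => by
    rw [interior_Ici] at hs ⊢
    exact (hd s hs).hasDerivWithinAt
  exact le_antisymm
    (antitoneOn_of_hasDerivWithinAt_nonpos (convex_Ici 0) hu.continuousOn hd'
      (fun _ _ => le_rfl) (Set.mem_Ici.2 le_rfl) ht ht)
    (monotoneOn_of_hasDerivWithinAt_nonneg (convex_Ici 0) hu.continuousOn hd'
      (fun _ _ => le_rfl) (Set.mem_Ici.2 le_rfl) ht ht)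

/-- Asymptotic consensus for scalar-valued trajectories that are continuous on the whole line. -/
lemma reaction_delay_consensus_scalar {N : ℕ} {τ lam : ℝ} (hτ : 0 < τ) (hlam : 0 ≤ lam)
    (hcond : (1 + lam) * τ < 1 / 2) {ψ : Fin N → Fin N → ℝ}
    (hsymm : ∀ i j, ψ i j = ψ j i) (hnonneg : ∀ i j, 0 ≤ ψ i j) (hstoch : ∀ i, ∑ j, ψ i j = 1)
    (hirr : IrreducibleWeights ψ) {X Xd : Fin N → ℝ → ℝ} (hX : ∀ i, Continuous (X i))
    (hd : ∀ i, ∀ t > -τ, HasDerivAt (X i) (Xd i t) t)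
    (hXd : ∀ i, ContinuousOn (Xd i) (Set.Ici (-τ)))
    (hode : ∀ t > 0, ∀ i, Xd i t = ∑ j, ψ i j *
      (X j (t - τ) + lam * τ * Xd j (t - τ) - X i (t - τ) - lam * τ * Xd i (t - τ)))
    (i : Fin N) :
    Filter.Tendsto (X i) Filter.atTop (nhds ((N : ℝ)⁻¹ * ∑ j, X j 0)) := by
  have hproj : ∀ (v : Fin N → ℝ) (ν : ℝ), (∀ i, ∑ j, ψ i j * v j = ν * v i) → ∀ t > 0,
      ∑ i, v i * Xd i t = -((1 - ν) * ∑ i, v i * X i (t - τ)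
        + (1 - ν) * (lam * τ) * ∑ i, v i * Xd i (t - τ)) := fun v ν hv t ht =>
    reaction_delay_projection hsymm hstoch hv (hode t ht)
  have hcont : ∀ v : Fin N → ℝ, Continuous fun t => ∑ i, v i * X i t := fun v =>
    continuous_finsetSum _ fun i _ => (hX i).const_smul (v i)
  have hderiv : ∀ v : Fin N → ℝ, ∀ t > -τ,
      HasDerivAt (fun t => ∑ i, v i * X i t) (∑ i, v i * Xd i t) t := fun v t ht =>
    HasDerivAt.fun_sum fun i _ => (hd i t ht).const_mul (v i)
  have hconst : ∀ v : Fin N → ℝ, (∀ i, ∑ j, ψ i j * v j = 1 * v i) → ∀ t ≥ 0,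
      ∑ i, v i * X i t = ∑ i, v i * X i 0 := fun v hv t ht =>
    eq_apply_zero_of_hasDerivAt_zero (hcont v)
      (fun s hs => (hderiv v s (by linarith [show (0 : ℝ) < s from hs])).congr_deriv
        ((hproj v 1 hv s hs).trans (by ring))) ht
  have hherm : (Matrix.of ψ).IsHermitian := Matrix.IsHermitian.ext fun i j => by
    simp [hsymm i j]
  set b := hherm.eigenvectorBasis
  set ν := hherm.eigenvalues
  have heig : ∀ k i, ∑ j, ψ i j * b k j = ν k * b k i := fun k i => by
    simpa [Matrix.mulVec, dotProduct] using congrFun (hherm.mulVec_eigenvectorBasis k) i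
  have hmode : ∀ k, ∃ l, ν k * l = l ∧
      Filter.Tendsto (fun t => ∑ i, b k i * X i t) Filter.atTop (nhds l) := fun k => by
    have hnorm : ∑ i, b k i ^ 2 = 1 := by
      simpa [b.orthonormal.1 k] using (EuclideanSpace.real_norm_sq_eq (b k)).symm
    have habs := abs_le.1 (abs_eigenvalue_weights_le_one hsymm hnonneg hstoch (heig k)
      (hnorm ▸ one_pos))
    rcases habs.2.eq_or_lt with h1 | h1
    · refine ⟨∑ i, b k i * X i 0, by rw [h1, one_mul], tendsto_const_nhds.congr' ?_⟩
      filter_upwards [Filter.eventually_ge_atTop 0] with t ht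
      exact (hconst _ (h1 ▸ heig k) t ht).symm
    · refine ⟨0, mul_zero _, tendsto_zero_of_neutral_delay (μ := 1 - ν k)
        (c := (1 - ν k) * (lam * τ)) hτ (by linarith)
        (mul_nonneg (by linarith) (by positivity)) ?_ (hcont _) (hderiv _)
        (continuousOn_finsetSum _ fun i _ => (hXd i).const_smul (b k i)) (hproj _ _ (heig k))⟩
      have : 0 < (1 + lam) * τ := by positivity
      nlinarith
  choose l hl hlim using hmode
  set m : Fin N → ℝ := fun i => ∑ k, b k i * l k with hm
  have hXlim : ∀ i, Filter.Tendsto (X i) Filter.atTop (nhds (m i)) := fun i => by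
    refine (tendsto_finsetSum Finset.univ fun k _ => (hlim k).const_mul (b k i)).congr fun t => ?_
    have h := congrArg (fun w : EuclideanSpace ℝ (Fin N) => w i)
      (b.sum_repr' (WithLp.toLp 2 fun j => X j t))
    simpa [PiLp.inner_apply, mul_comm] using h
  have hmfix : ∀ i, ∑ j, ψ i j * m j = m i := fun i => by
    calc ∑ j, ψ i j * m j = ∑ k, (∑ j, ψ i j * b k j) * l k := by
          simp_rw [hm, Finset.mul_sum, Finset.sum_mul]
          rw [Finset.sum_comm]
          exact Finset.sum_congr rfl fun k _ => Finset.sum_congr rfl fun j _ => by ring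
      _ = m i := Finset.sum_congr rfl fun k _ => by rw [heig, mul_comm (ν k), mul_assoc, hl]
  have hsum : ∑ j, m j = ∑ j, X j 0 := by
    refine tendsto_nhds_unique (tendsto_finsetSum Finset.univ fun j _ => hXlim j)
      (tendsto_const_nhds.congr' ?_)
    filter_upwards [Filter.eventually_ge_atTop 0] with t ht
    simpa using (hconst (fun _ => 1) (by simpa using hstoch) t ht).symm
  have hN : (N : ℝ) ≠ 0 := Nat.cast_ne_zero.2 (Fin.pos i).ne'
  have hmi : m i = (N : ℝ)⁻¹ * ∑ j, X j 0 := by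
    rw [← hsum, Finset.sum_congr rfl fun j _ =>
      eq_of_weights_fixed hsymm hnonneg hstoch hirr hmfix j i]
    simp [hN]
  exact hmi ▸ hXlim i

/-- **Asymptotic consensus for the reaction-type delay system.**
If the weights are symmetric, bi-stochastic and irreducible and `(1+λ)τ < 1/2`, then every
solution converges to the consensus state given by the initial mean `X(0)`. -/
theorem reaction_delay_consensus {N d : ℕ} (hN : 2 ≤ N) (hd : 1 ≤ d)
    (τ lam : ℝ) (hτ : 0 < τ) (hlam : 0 ≤ lam)
    (hcond : (1 + lam) * τ < 1 / 2)
    (ψ : Fin N → Fin N → ℝ)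
    (hψsymm : ∀ i j : Fin N, ψ i j = ψ j i)
    (hψnonneg : ∀ i j : Fin N, 0 ≤ ψ i j)
    (hψstoch : ∀ i : Fin N, ∑ j : Fin N, ψ i j = 1)
    (hψirr : IrreducibleWeights ψ)
    (x xd : Fin N → ℝ → EuclideanSpace ℝ (Fin d))
    (hderiv : ∀ i, ∀ t ∈ Set.Ici (-τ), HasDerivWithinAt (x i) (xd i t) (Set.Ici (-τ)) t)
    (hcont : ∀ i, ContinuousOn (xd i) (Set.Ici (-τ)))
    (hode : ∀ t > (0 : ℝ), ∀ i, xd i t =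
      ∑ j : Fin N, ψ i j •
        (x j (t - τ) + (lam * τ) • xd j (t - τ) - x i (t - τ) - (lam * τ) • xd i (t - τ))) :
    ∀ i : Fin N, Filter.Tendsto (x i) Filter.atTop
      (nhds ((N : ℝ)⁻¹ • ∑ j : Fin N, x j 0)) := by
  intro i
  have hmem : ∀ t > (0 : ℝ), t - τ ∈ Set.Ici (-τ) := fun t ht => by
    simpa using (show (0 : ℝ) < t from ht).le
  have hext : ∀ t ∈ Set.Ici (-τ), max t (-τ) = t := fun t ht => max_eq_left ht
  have hproj : Continuous fun t : ℝ => max t (-τ) := by fun_prop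
  have hcoord : ∀ k : Fin d, Filter.Tendsto (fun t => x i t k) Filter.atTop
      (nhds ((N : ℝ)⁻¹ * ∑ j, x j 0 k)) := fun k => by
    have hev : ∀ j, ∀ s ∈ Set.Ici (-τ), x j (max s (-τ)) k = x j s k := fun j s hs => by
      rw [hext s hs]
    have h := reaction_delay_consensus_scalar hτ hlam hcond hψsymm hψnonneg hψstoch hψirr
      (X := fun j t => x j (max t (-τ)) k) (Xd := fun j t => xd j t k) ?_ ?_ ?_ ?_ i
    · simp only [hev _ 0 (by simpa using hτ.le)] at h
      refine h.congr' ?_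
      filter_upwards [Filter.eventually_ge_atTop (-τ)] with t ht using hev i t ht
    · intro j
      have hxc : ContinuousOn (x j) (Set.Ici (-τ)) := fun t ht =>
        (hderiv j t ht).continuousWithinAt
      exact (EuclideanSpace.proj (𝕜 := ℝ) k).continuous.comp
        (hxc.comp_continuous hproj fun t => Set.mem_Ici.2 (le_max_right _ _))
    · intro j t ht
      have hnhds : Set.Ici (-τ) ∈ nhds t := Ici_mem_nhds ht
      have h := (EuclideanSpace.proj (𝕜 := ℝ) k).hasFDerivAt.comp_hasDerivAt t
        ((hderiv j t (le_of_lt ht)).hasDerivAt hnhds)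
      exact h.congr_of_eventuallyEq (Filter.eventually_of_mem hnhds (hev j))
    · intro j
      exact (EuclideanSpace.proj (𝕜 := ℝ) k).continuous.comp_continuousOn (hcont j)
    · intro t ht j
      simp [hode t ht j, hext _ (hmem t ht)]
  have hpi : Filter.Tendsto (fun t => (x i t).ofLp) Filter.atTop
      (nhds ((N : ℝ)⁻¹ • ∑ j : Fin N, x j 0).ofLp) :=
    tendsto_pi_nhds.2 fun k => by simpa using hcoord k
  exact ((PiLp.continuous_toLp 2 _).tendsto _).comp hpi
end

section
/- Let the weights ψ be row-stochastic with nonnegative entries, let λτ ≤ 1, and let x be a solution of the transmission-delay system. Set M := max_{t ∈ [−τ,0]} max_{i ∈ [N]} max{ |x_i(t)|, |x_i'(t)| }. Then for all t > 0 and all i ∈ [N]: |x_i(t)| ≤ (1+λτ) M and |x_i'(t)| ≤ 3(1+λτ) M. -/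
open Finset

/-- If `‖f + f'‖ ≤ K` on `[a, b)` and `‖f a‖ ≤ K`, then `‖f‖ ≤ K` on `[a, b]`. -/
theorem norm_le_of_norm_add_deriv_right_le {E : Type*} [NormedAddCommGroup E] [NormedSpace ℝ E]
    {f f' : ℝ → E} {a b K : ℝ} (hf : ContinuousOn f (Set.Icc a b))
    (hf' : ∀ t ∈ Set.Ico a b, HasDerivWithinAt f (f' t) (Set.Ici t) t)
    (ha : ‖f a‖ ≤ K) (bound : ∀ t ∈ Set.Ico a b, ‖f t + f' t‖ ≤ K) :
    ∀ t ∈ Set.Icc a b, ‖f t‖ ≤ K := by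
  intro t ht
  have key : ‖Real.exp t • f t‖ ≤ Real.exp t * K := by
    refine image_norm_le_of_norm_deriv_right_le_deriv_boundary
      (f := fun s => Real.exp s • f s) (f' := fun s => Real.exp s • f' s + Real.exp s • f s)
      (B := fun s => Real.exp s * K) (B' := fun s => Real.exp s * K)
      (Real.continuous_exp.continuousOn.smul hf)
      (fun s hs => (Real.hasDerivAt_exp s).hasDerivWithinAt.smul (hf' s hs)) ?_
      (fun s => (Real.hasDerivAt_exp s).mul_const K) ?_ ht
    · simp only [norm_smul, Real.norm_eq_abs, Real.abs_exp]
      gcongr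
    · intro s hs
      rw [← smul_add, norm_smul, Real.norm_eq_abs, Real.abs_exp, add_comm]
      gcongr
      exact bound s hs
  rw [norm_smul, Real.norm_eq_abs, Real.abs_exp] at key
  exact le_of_mul_le_mul_left key (Real.exp_pos t)

/-- A weighted sum, with nonnegative weights of total mass one, of vectors of norm at most `K`
has norm at most `K`. -/
theorem norm_sum_smul_le_of_sum_eq_one {ι E : Type*} [NormedAddCommGroup E] [NormedSpace ℝ E]
    {s : Finset ι} {w : ι → ℝ} {v : ι → E} {K : ℝ} (hw : ∀ j ∈ s, 0 ≤ w j)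
    (hw1 : ∑ j ∈ s, w j = 1) (hv : ∀ j ∈ s, ‖v j‖ ≤ K) : ‖∑ j ∈ s, w j • v j‖ ≤ K := by
  calc ‖∑ j ∈ s, w j • v j‖ ≤ ∑ j ∈ s, w j * K := by
        refine norm_sum_le_of_le s fun j hj => ?_
        rw [norm_smul, Real.norm_of_nonneg (hw j hj)]
        exact mul_le_mul_of_nonneg_left (hv j hj) (hw j hj)
    _ = K := by rw [← Finset.sum_mul, hw1, one_mul]

/-- **Uniform a priori bounds for the transmission-type delay system.**
If `λτ ≤ 1` and `M` bounds the initial datum and its derivative on `[-τ,0]`, then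
`|x_i(t)| ≤ (1+λτ) M` and `|x_i'(t)| ≤ 3(1+λτ) M` for all `t > 0`. -/
theorem transmission_delay_uniform_bounds {N d : ℕ} (hN : 2 ≤ N) (hd : 1 ≤ d)
    (τ lam : ℝ) (hτ : 0 < τ) (hlam : 0 ≤ lam) (hlamτ : lam * τ ≤ 1)
    (ψ : Fin N → Fin N → ℝ)
    (hψnonneg : ∀ i j : Fin N, 0 ≤ ψ i j)
    (hψstoch : ∀ i : Fin N, ∑ j ∈ Finset.univ.erase i, ψ i j = 1)
    (x xd : Fin N → ℝ → EuclideanSpace ℝ (Fin d))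
    (hderiv : ∀ i, ∀ t ∈ Set.Ici (-τ), HasDerivWithinAt (x i) (xd i t) (Set.Ici (-τ)) t)
    (hcont : ∀ i, ContinuousOn (xd i) (Set.Ici (-τ)))
    (hode : ∀ t > (0 : ℝ), ∀ i, xd i t =
      ∑ j ∈ Finset.univ.erase i, ψ i j • (x j (t - τ) + (lam * τ) • xd j (t - τ) - x i t))
    (M : ℝ)
    (hM : M = ⨆ i : Fin N, ⨆ t : Set.Icc (-τ) (0 : ℝ), max ‖x i t‖ ‖xd i t‖) :
    ∀ t > (0 : ℝ), ∀ i : Fin N,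
      ‖x i t‖ ≤ (1 + lam * τ) * M ∧ ‖xd i t‖ ≤ 3 * (1 + lam * τ) * M := by
  have hxc : ∀ i, ContinuousOn (x i) (Set.Ici (-τ)) :=
    fun i t ht => (hderiv i t ht).continuousWithinAt
  have hinit : ∀ i, ∀ t ∈ Set.Icc (-τ) 0, ‖x i t‖ ≤ M ∧ ‖xd i t‖ ≤ M := by
    intro i t ht
    have hb : BddAbove (Set.range fun t : Set.Icc (-τ) (0 : ℝ) => max ‖x i t‖ ‖xd i t‖) := by
      have hc : ContinuousOn (fun t => max ‖x i t‖ ‖xd i t‖) (Set.Icc (-τ) 0) :=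
        ((hxc i).norm.sup (hcont i).norm).mono Set.Icc_subset_Ici_self
      have := isCompact_Icc.bddAbove_image hc
      rwa [Set.image_eq_range] at this
    have h1 := le_ciSup hb ⟨t, ht⟩
    have h2 := le_ciSup (Set.finite_range fun i : Fin N =>
      ⨆ t : Set.Icc (-τ) (0 : ℝ), max ‖x i t‖ ‖xd i t‖).bddAbove i
    have h3 : max ‖x i t‖ ‖xd i t‖ ≤ M := hM ▸ h1.trans h2
    exact max_le_iff.mp h3
  set a := lam * τ with ha_def
  have ha : 0 ≤ a := mul_nonneg hlam hτ.le
  set K := (1 + a) * M with hK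
  have hsum : ∀ t > 0, ∀ i, x i t + xd i t =
      ∑ j ∈ Finset.univ.erase i, ψ i j • (x j (t - τ) + a • xd j (t - τ)) := by
    intro t ht i
    rw [hode t ht i]
    simp only [smul_sub (ψ _ _), Finset.sum_sub_distrib, ← Finset.sum_smul, hψstoch, one_smul]
    abel
  have hbound : ∀ n : ℕ, ∀ i, ∀ t ∈ Set.Icc (-τ) (n * τ),
      ‖x i t‖ ≤ K ∧ ‖x i t + a • xd i t‖ ≤ K ∧ (0 < t → ‖x i t + xd i t‖ ≤ K) := by
    intro n
    induction n with
    | zero =>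
      intro i t ht
      have ht : t ∈ Set.Icc (-τ) 0 := by simpa using ht
      obtain ⟨h1, h2⟩ := hinit i t ht
      have hM0 : 0 ≤ M := (norm_nonneg _).trans h1
      refine ⟨by nlinarith, ?_, fun h => absurd ht.2 h.not_ge⟩
      refine (norm_add_le _ _).trans ?_
      rw [norm_smul, Real.norm_of_nonneg ha]
      nlinarith
    | succ n ih =>
      have hF : ∀ i, ∀ t ∈ Set.Ioc 0 ((n + 1 : ℝ) * τ), ‖x i t + xd i t‖ ≤ K := by
        intro i t ht
        rw [hsum t ht.1 i]
        refine norm_sum_smul_le_of_sum_eq_one (fun j _ => hψnonneg i j) (hψstoch i) fun j _ => ?_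
        exact (ih j (t - τ) ⟨by linarith [ht.1], by linarith [ht.2]⟩).2.1
      have hT : 0 < (n + 1 : ℝ) * τ := by positivity
      have hF0 : ∀ i, ‖x i 0 + xd i 0‖ ≤ K := by
        intro i
        have hc : ContinuousWithinAt (fun t => ‖x i t + xd i t‖) (Set.Ioi 0) 0 :=
          ((((hxc i).add (hcont i)).norm) 0 (by simp [hτ.le])).mono fun s (hs : 0 < s) => by
            simp only [Set.mem_Ici]; linarith
        refine le_of_tendsto hc ?_
        filter_upwards [Ioc_mem_nhdsGT hT] with s hs using hF i s hs
      have hx : ∀ i, ∀ t ∈ Set.Icc 0 ((n + 1 : ℝ) * τ), ‖x i t‖ ≤ K := by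
        intro i
        refine norm_le_of_norm_add_deriv_right_le (f' := xd i)
          ((hxc i).mono fun s hs => ?_) (fun t ht => (hderiv i t ?_).mono ?_) ?_ ?_
        · simp only [Set.mem_Ici]; linarith [hs.1]
        · simp only [Set.mem_Ici]; linarith [ht.1]
        · exact Set.Ici_subset_Ici.mpr (by linarith [ht.1])
        · exact (ih i 0 ⟨by linarith, by positivity⟩).1
        · intro t ht
          rcases ht.1.eq_or_lt with h | h
          · exact h ▸ hF0 i
          · exact hF i t ⟨h, ht.2.le⟩
      intro i t ht
      push_cast at ht
      rcases le_or_gt t 0 with h | h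
      · exact ih i t ⟨ht.1, h.trans (by positivity)⟩
      · have h1 := hx i t ⟨h.le, ht.2⟩
        have h2 := hF i t ⟨h, ht.2⟩
        refine ⟨h1, ?_, fun _ => h2⟩
        have hconv : x i t + a • xd i t = (1 - a) • x i t + a • (x i t + xd i t) := by module
        rw [hconv]
        refine (norm_add_le _ _).trans ?_
        rw [norm_smul, norm_smul, Real.norm_of_nonneg ha, Real.norm_of_nonneg (by linarith)]
        nlinarith
  intro t ht i
  obtain ⟨n, hn⟩ := exists_nat_ge (t / τ)
  obtain ⟨h1, -, h2⟩ := hbound n i t ⟨by linarith, (div_le_iff₀ hτ).mp hn⟩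
  refine ⟨h1, ?_⟩
  have h3 : ‖xd i t‖ ≤ ‖x i t + xd i t‖ + ‖x i t‖ := by
    simpa using norm_sub_le (x i t + xd i t) (x i t)
  have h4 : 0 ≤ K := (norm_nonneg _).trans h1
  linarith [h2 ht]
end

section
/- Let N ≥ 3, let the weights ψ be row-stochastic and positive, let λτ ≤ 1, and let x be a solution of the transmission-delay system. Assume there exist T_0 > 0 and fixed indices I, J with d_x(t) = |x_I(t) − x_J(t)| for all t ≥ T_0. Then the function t ↦ d_x(t)² is integrable on (T_0, ∞), i.e., ∫_{T_0}^∞ d_x(s)² ds < ∞. -/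
open Finset MeasureTheory

/-- A Dobrushin-type contraction: two weighted means which share the index `m` differ by at most
`(1 - p m * q m)` times the diameter of the averaged family. -/
theorem norm_weighted_sum_sub_le {ι E : Type*} [NormedAddCommGroup E] [NormedSpace ℝ E]
    [DecidableEq ι] {s t : Finset ι} {p q : ι → ℝ} {z : ι → E} {D : ℝ} {m : ι}
    (hp : ∀ j ∈ s, 0 ≤ p j) (hq : ∀ l ∈ t, 0 ≤ q l)
    (hps : ∑ j ∈ s, p j = 1) (hqt : ∑ l ∈ t, q l = 1) (hms : m ∈ s) (hmt : m ∈ t)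
    (hz : ∀ j l, ‖z j - z l‖ ≤ D) :
    ‖∑ j ∈ s, p j • z j - ∑ l ∈ t, q l • z l‖ ≤ (1 - p m * q m) * D := by
  have hD : 0 ≤ D := (norm_nonneg _).trans (hz m m)
  have hleft : ∑ j ∈ s, p j • z j = ∑ j ∈ s, ∑ l ∈ t, (p j * q l) • z j := by
    refine Finset.sum_congr rfl fun j _ => ?_
    rw [← Finset.sum_smul, ← Finset.mul_sum, hqt, mul_one]
  have hright : ∑ l ∈ t, q l • z l = ∑ j ∈ s, ∑ l ∈ t, (p j * q l) • z l := by
    rw [Finset.sum_comm]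
    refine Finset.sum_congr rfl fun l _ => ?_
    rw [← Finset.sum_smul, ← Finset.sum_mul, hps, one_mul]
  have hsum : ∑ j ∈ s, p j • z j - ∑ l ∈ t, q l • z l
      = ∑ a ∈ s ×ˢ t, (p a.1 * q a.2) • (z a.1 - z a.2) := by
    rw [hleft, hright, Finset.sum_product, ← Finset.sum_sub_distrib]
    refine Finset.sum_congr rfl fun j _ => ?_
    rw [← Finset.sum_sub_distrib]
    exact Finset.sum_congr rfl fun l _ => (smul_sub _ _ _).symm
  have htotal : ∑ a ∈ s ×ˢ t, p a.1 * q a.2 = 1 := by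
    rw [Finset.sum_product, ← Finset.sum_mul_sum, hps, hqt, one_mul]
  have hm : (m, m) ∈ s ×ˢ t := Finset.mk_mem_product hms hmt
  rw [hsum, ← Finset.add_sum_erase _ _ hm, sub_self, smul_zero, zero_add]
  calc ‖∑ a ∈ (s ×ˢ t).erase (m, m), (p a.1 * q a.2) • (z a.1 - z a.2)‖
      ≤ ∑ a ∈ (s ×ˢ t).erase (m, m), (p a.1 * q a.2) * D := by
        refine norm_sum_le_of_le _ fun a ha => ?_
        obtain ⟨ha₁, ha₂⟩ := Finset.mem_product.1 (Finset.mem_of_mem_erase ha)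
        have hnn : 0 ≤ p a.1 * q a.2 := mul_nonneg (hp _ ha₁) (hq _ ha₂)
        rw [norm_smul, Real.norm_of_nonneg hnn]
        exact mul_le_mul_of_nonneg_left (hz _ _) hnn
    _ = (1 - p m * q m) * D := by
        rw [← Finset.sum_mul, ← htotal, ← Finset.add_sum_erase _ _ hm, add_sub_cancel_left]

/-- Positive row-stochastic weights off the diagonal on at least three agents contract diameters
by a uniform factor. -/
theorem exists_contraction_of_pos_weights {N : ℕ} (hN : 3 ≤ N) (E : Type*)
    [NormedAddCommGroup E] [NormedSpace ℝ E] {ψ : Fin N → Fin N → ℝ}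
    (hψpos : ∀ i j : Fin N, i ≠ j → 0 < ψ i j)
    (hψstoch : ∀ i : Fin N, ∑ j ∈ Finset.univ.erase i, ψ i j = 1) :
    ∃ α : ℝ, 0 ≤ α ∧ α < 1 ∧ ∀ (z : Fin N → E) (D : ℝ), (∀ j l, ‖z j - z l‖ ≤ D) → ∀ i k,
      ‖∑ j ∈ Finset.univ.erase i, ψ i j • z j - ∑ j ∈ Finset.univ.erase k, ψ k j • z j‖
        ≤ α * D := by
  have : Nonempty (Fin N) := ⟨⟨0, by omega⟩⟩
  obtain ⟨a, ha⟩ := Finite.exists_min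
    fun a : Fin N × Fin N => if a.1 = a.2 then (1 : ℝ) else ψ a.1 a.2
  set ε : ℝ := if a.1 = a.2 then (1 : ℝ) else ψ a.1 a.2 with hε
  have hε0 : 0 < ε := by
    rw [hε]
    split_ifs with h
    exacts [one_pos, hψpos _ _ h]
  have hεψ : ∀ i j, i ≠ j → ε ≤ ψ i j := fun i j hij => by simpa [hij] using ha (i, j)
  have hε1 : ε ≤ 1 := by simpa using ha (a.1, a.1)
  refine ⟨1 - ε * ε, by nlinarith, by nlinarith, fun z D hz i k => ?_⟩
  have hD : 0 ≤ D := (norm_nonneg _).trans (hz i i)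
  obtain ⟨m, hm⟩ : ∃ m, m ∉ ({i, k} : Finset (Fin N)) := by
    by_contra! h
    have hcard := Finset.card_le_two (a := i) (b := k)
    rw [Finset.eq_univ_of_forall h, Finset.card_univ, Fintype.card_fin] at hcard
    omega
  simp only [Finset.mem_insert, Finset.mem_singleton, not_or] at hm
  have hnn : ∀ r, ∀ j ∈ Finset.univ.erase r, 0 ≤ ψ r j := fun r j hj =>
    (hψpos r j (Finset.ne_of_mem_erase hj).symm).le
  refine (norm_weighted_sum_sub_le (hnn i) (hnn k) (hψstoch i) (hψstoch k)
    (Finset.mem_erase.2 ⟨hm.1, Finset.mem_univ m⟩)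
    (Finset.mem_erase.2 ⟨hm.2, Finset.mem_univ m⟩) hz).trans ?_
  have := mul_le_mul (hεψ i m (Ne.symm hm.1)) (hεψ k m (Ne.symm hm.2)) hε0.le
    (hψpos i m (Ne.symm hm.1)).le
  gcongr

/-- If `α < 1`, the inequality `α * exp (δ * τ) ≤ 1 - δ` holds for some rate `δ ∈ (0, 1)`. -/
theorem exists_rate_mul_exp_le {α : ℝ} (hα : α < 1) (τ : ℝ) :
    ∃ δ : ℝ, 0 < δ ∧ δ < 1 ∧ α * Real.exp (δ * τ) ≤ 1 - δ := by
  have hcont : Continuous fun δ : ℝ => 1 - δ - α * Real.exp (δ * τ) := by fun_prop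
  have hev : ∀ᶠ δ in nhds (0 : ℝ), 0 < 1 - δ - α * Real.exp (δ * τ) :=
    hcont.continuousAt.eventually_const_lt (by simpa using hα)
  have hev' : ∀ᶠ δ in nhdsWithin (0 : ℝ) (Set.Ioi 0),
      0 < 1 - δ - α * Real.exp (δ * τ) ∧ δ < 1 ∧ 0 < δ :=
    (hev.filter_mono nhdsWithin_le_nhds).and
      (((eventually_lt_nhds one_pos).filter_mono nhdsWithin_le_nhds).and self_mem_nhdsWithin)
  obtain ⟨δ, h, h1, h0⟩ := hev'.exists
  exact ⟨δ, h0, h1, by linarith⟩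

/-- If `u + u'` decays at rate `δ < 1`, so does `u`. -/
theorem norm_le_mul_exp_of_norm_add_deriv_le {E : Type*} [NormedAddCommGroup E] [NormedSpace ℝ E]
    {u ud : ℝ → E} {b δ T : ℝ}
    (hu : ∀ t ∈ Set.Icc 0 T, HasDerivWithinAt u (ud t) (Set.Ici t) t)
    (hcont : ContinuousOn u (Set.Icc 0 T)) (h0 : ‖u 0‖ ≤ b)
    (hv : ∀ t ∈ Set.Icc 0 T, ‖u t + ud t‖ ≤ (1 - δ) * b * Real.exp (-δ * t)) :
    ∀ t ∈ Set.Icc 0 T, ‖u t‖ ≤ b * Real.exp (-δ * t) := by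
  intro t ht
  have hB : ∀ r : ℝ, HasDerivAt (fun r => b * Real.exp ((1 - δ) * r))
      (b * (Real.exp ((1 - δ) * r) * (1 - δ))) r := fun r => by
    simpa using (((hasDerivAt_id r).const_mul (1 - δ)).exp).const_mul b
  have hmain : ‖Real.exp t • u t‖ ≤ b * Real.exp ((1 - δ) * t) := by
    refine image_norm_le_of_norm_deriv_right_le_deriv_boundary
      (f := fun r => Real.exp r • u r) (f' := fun r => Real.exp r • ud r + Real.exp r • u r)
      (B := fun r => b * Real.exp ((1 - δ) * r)) (a := 0) (b := T)
      (Real.continuous_exp.continuousOn.smul hcont) (fun r hr => ?_) (by simpa using h0)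
      hB (fun r hr => ?_) ht
    · exact (Real.hasDerivAt_exp r).hasDerivWithinAt.smul (hu r (Set.Ico_subset_Icc_self hr))
    · rw [← smul_add, norm_smul, Real.norm_of_nonneg (Real.exp_pos r).le, add_comm]
      calc Real.exp r * ‖u r + ud r‖
          ≤ Real.exp r * ((1 - δ) * b * Real.exp (-δ * r)) := by
            gcongr
            exact hv r (Set.Ico_subset_Icc_self hr)
        _ = b * (Real.exp ((1 - δ) * r) * (1 - δ)) := by
            rw [show (1 - δ) * r = r + -δ * r by ring, Real.exp_add]
            ring
  rw [norm_smul, Real.norm_of_nonneg (Real.exp_pos t).le,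
    show (1 - δ) * t = t + -δ * t by ring, Real.exp_add] at hmain
  refine le_of_mul_le_mul_left ?_ (Real.exp_pos t)
  linarith

/-- Exponential consensus: all differences `x i - x k` of a solution of the transmission-delay
system decay at a common exponential rate. -/
theorem exists_norm_sub_le_mul_exp {N : ℕ} {E : Type*} [NormedAddCommGroup E] [NormedSpace ℝ E]
    (hN : 3 ≤ N) {τ c : ℝ} (hτ : 0 < τ) (hc0 : 0 ≤ c) (hc1 : c ≤ 1) {ψ : Fin N → Fin N → ℝ}
    (hψpos : ∀ i j : Fin N, i ≠ j → 0 < ψ i j)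
    (hψstoch : ∀ i : Fin N, ∑ j ∈ Finset.univ.erase i, ψ i j = 1)
    {x xd : Fin N → ℝ → E}
    (hderiv : ∀ i, ∀ t ∈ Set.Ici (-τ), HasDerivWithinAt (x i) (xd i t) (Set.Ici (-τ)) t)
    (hcont : ∀ i, ContinuousOn (xd i) (Set.Ici (-τ)))
    (hode : ∀ t > (0 : ℝ), ∀ i, xd i t =
      ∑ j ∈ Finset.univ.erase i, ψ i j • (x j (t - τ) + c • xd j (t - τ) - x i t)) :
    ∃ b δ : ℝ, 0 < δ ∧ ∀ t ≥ 0, ∀ i k, ‖x i t - x k t‖ ≤ b * Real.exp (-δ * t) := by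
  obtain ⟨α, hα0, hα1, hα⟩ := exists_contraction_of_pos_weights hN E hψpos hψstoch
  obtain ⟨δ, hδ0, hδ1, hδ⟩ := exists_rate_mul_exp_le hα1 τ
  have hxcont : ∀ i, ContinuousOn (x i) (Set.Ici (-τ)) := fun i t ht =>
    (hderiv i t ht).continuousWithinAt
  have hbdd : ∃ C, ∀ i k, ∀ s ∈ Set.Icc (-τ) 0,
      ‖x i s - x k s‖ ≤ C ∧ ‖(x i s - x k s) + (xd i s - xd k s)‖ ≤ C := by
    have hC : ∀ i, ∃ C, ∀ s ∈ Set.Icc (-τ) 0, ‖x i s‖ ≤ C ∧ ‖xd i s‖ ≤ C := fun i => by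
      obtain ⟨C₁, hC₁⟩ := isCompact_Icc.exists_bound_of_continuousOn
        ((hxcont i).mono (Set.Icc_subset_Ici_self : Set.Icc (-τ) 0 ⊆ _))
      obtain ⟨C₂, hC₂⟩ := isCompact_Icc.exists_bound_of_continuousOn
        ((hcont i).mono (Set.Icc_subset_Ici_self : Set.Icc (-τ) 0 ⊆ _))
      exact ⟨max C₁ C₂, fun s hs =>
        ⟨(hC₁ s hs).trans (le_max_left _ _), (hC₂ s hs).trans (le_max_right _ _)⟩⟩
    choose C hC using hC
    obtain ⟨M, hM⟩ := Finite.bddAbove_range C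
    refine ⟨4 * M, fun i k s hs => ?_⟩
    have hi := hC i s hs
    have hk := hC k s hs
    have hMi : C i ≤ M := hM ⟨i, rfl⟩
    have hMk : C k ≤ M := hM ⟨k, rfl⟩
    have hu := norm_sub_le (x i s) (x k s)
    have hud := norm_sub_le (xd i s) (xd k s)
    have hv := norm_add_le (x i s - x k s) (xd i s - xd k s)
    have := norm_nonneg (x i s)
    constructor <;> linarith
  obtain ⟨C, hC⟩ := hbdd
  have hC0 : 0 ≤ C :=
    (norm_nonneg _).trans (hC ⟨0, by omega⟩ ⟨0, by omega⟩ 0 ⟨by linarith, le_rfl⟩).1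
  obtain ⟨b, hb⟩ : ∃ b, (1 - δ) * b = C := ⟨C / (1 - δ), by field_simp [(sub_pos.2 hδ1).ne']⟩
  have hb0 : 0 ≤ b := nonneg_of_mul_nonneg_right (hb ▸ hC0) (sub_pos.2 hδ1)
  have hCb : C ≤ b := by nlinarith
  have hsplit : ∀ t > (0 : ℝ), ∀ i, x i t + xd i t =
      ∑ j ∈ Finset.univ.erase i, ψ i j • (x j (t - τ) + c • xd j (t - τ)) := fun t ht i => by
    rw [hode t ht i]
    simp only [smul_sub (ψ i _) (_ + _)]
    rw [Finset.sum_sub_distrib, ← Finset.sum_smul, hψstoch i, one_smul, add_sub_cancel]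
  have hind : ∀ n : ℕ, ∀ s ∈ Set.Icc (-τ) (n * τ), ∀ i k,
      ‖x i s - x k s‖ ≤ b * Real.exp (-δ * s) ∧
      ‖(x i s - x k s) + (xd i s - xd k s)‖ ≤ (1 - δ) * b * Real.exp (-δ * s) := by
    intro n
    induction n with
    | zero =>
      intro s hs i k
      rw [Nat.cast_zero, zero_mul] at hs
      have hexp : 1 ≤ Real.exp (-δ * s) := Real.one_le_exp (by nlinarith [hs.2])
      obtain ⟨h₁, h₂⟩ := hC i k s hs
      rw [hb]
      exact ⟨h₁.trans (hCb.trans (le_mul_of_one_le_right hb0 hexp)),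
        h₂.trans (le_mul_of_one_le_right hC0 hexp)⟩
    | succ n ih =>
      have hnτ : 0 ≤ (n : ℝ) * τ := by positivity
      have hv : ∀ s ∈ Set.Icc (-τ) ((n + 1 : ℕ) * τ), ∀ i k,
          ‖(x i s - x k s) + (xd i s - xd k s)‖ ≤ (1 - δ) * b * Real.exp (-δ * s) := by
        intro s hs i k
        rcases le_or_gt s (n * τ) with hsn | hsn
        · exact (ih s ⟨hs.1, hsn⟩ i k).2
        have hs0 : 0 < s := hnτ.trans_lt hsn
        have hmem : s - τ ∈ Set.Icc (-τ) (n * τ) := by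
          have := hs.2
          push_cast at this
          constructor <;> linarith
        have hz : ∀ j l, ‖(x j (s - τ) + c • xd j (s - τ)) - (x l (s - τ) + c • xd l (s - τ))‖
            ≤ b * Real.exp (-δ * (s - τ)) := by
          intro j l
          obtain ⟨hu, hw⟩ := ih (s - τ) hmem j l
          have hexp := Real.exp_pos (-δ * (s - τ))
          have hw' : ‖(x j (s - τ) - x l (s - τ)) + (xd j (s - τ) - xd l (s - τ))‖
              ≤ b * Real.exp (-δ * (s - τ)) :=
            hw.trans (mul_le_mul_of_nonneg_right (by nlinarith) hexp.le)
          calc ‖(x j (s - τ) + c • xd j (s - τ)) - (x l (s - τ) + c • xd l (s - τ))‖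
              = ‖(1 - c) • (x j (s - τ) - x l (s - τ)) +
                  c • ((x j (s - τ) - x l (s - τ)) + (xd j (s - τ) - xd l (s - τ)))‖ := by
                congr 1
                module
            _ ≤ (1 - c) * ‖x j (s - τ) - x l (s - τ)‖ +
                  c * ‖(x j (s - τ) - x l (s - τ)) + (xd j (s - τ) - xd l (s - τ))‖ := by
                refine (norm_add_le _ _).trans_eq ?_
                rw [norm_smul, norm_smul, Real.norm_of_nonneg hc0,
                  Real.norm_of_nonneg (sub_nonneg.2 hc1)]
            _ ≤ (1 - c) * (b * Real.exp (-δ * (s - τ))) +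
                  c * (b * Real.exp (-δ * (s - τ))) :=
                add_le_add (mul_le_mul_of_nonneg_left hu (sub_nonneg.2 hc1))
                  (mul_le_mul_of_nonneg_left hw' hc0)
            _ = b * Real.exp (-δ * (s - τ)) := by ring
        calc ‖(x i s - x k s) + (xd i s - xd k s)‖
            = ‖(x i s + xd i s) - (x k s + xd k s)‖ := by
              congr 1
              abel
          _ ≤ α * (b * Real.exp (-δ * (s - τ))) := by
              rw [hsplit s hs0 i, hsplit s hs0 k]
              exact hα _ _ hz i k
          _ = α * Real.exp (δ * τ) * (b * Real.exp (-δ * s)) := by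
              rw [show -δ * (s - τ) = δ * τ + -δ * s by ring, Real.exp_add]
              ring
          _ ≤ (1 - δ) * (b * Real.exp (-δ * s)) := by gcongr
          _ = (1 - δ) * b * Real.exp (-δ * s) := by ring
      intro s hs i k
      refine ⟨?_, hv s hs i k⟩
      rcases le_or_gt s 0 with hs0 | hs0
      · exact (ih s ⟨hs.1, hs0.trans hnτ⟩ i k).1
      have hsub : ∀ r : ℝ, 0 ≤ r → r ∈ Set.Ici (-τ) := fun r hr =>
        Set.mem_Ici.2 (by linarith)
      refine norm_le_mul_exp_of_norm_add_deriv_le (u := fun r => x i r - x k r)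
        (ud := fun r => xd i r - xd k r) (T := (n + 1 : ℕ) * τ) (fun r hr => ?_) ?_ ?_
        (fun r hr => hv r ⟨hsub r hr.1, hr.2⟩ i k) s ⟨hs0.le, hs.2⟩
      · exact ((hderiv i r (hsub r hr.1)).sub (hderiv k r (hsub r hr.1))).mono
          (Set.Ici_subset_Ici.2 (hsub r hr.1))
      · exact ((hxcont i).sub (hxcont k)).mono fun r hr => hsub r hr.1
      · exact (hC i k 0 ⟨by linarith, le_rfl⟩).1.trans hCb
  refine ⟨b, δ, hδ0, fun t ht i k => ?_⟩
  obtain ⟨n, hn⟩ := exists_nat_ge (t / τ)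
  exact (hind n t ⟨by linarith, (div_le_iff₀ hτ).1 hn⟩ i k).1

/-- **Square-integrability of the discord for the transmission-type delay system.**
Under the hypotheses of the consensus theorem, `t ↦ d_x(t)²` is integrable on `(T₀, ∞)`. -/
theorem transmission_delay_discord_sq_integrable {N d : ℕ} (hN : 3 ≤ N) (hd : 1 ≤ d)
    (τ lam : ℝ) (hτ : 0 < τ) (hlam : 0 ≤ lam) (hlamτ : lam * τ ≤ 1)
    (ψ : Fin N → Fin N → ℝ)
    (hψpos : ∀ i j : Fin N, i ≠ j → 0 < ψ i j)
    (hψstoch : ∀ i : Fin N, ∑ j ∈ Finset.univ.erase i, ψ i j = 1)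
    (x xd : Fin N → ℝ → EuclideanSpace ℝ (Fin d))
    (hderiv : ∀ i, ∀ t ∈ Set.Ici (-τ), HasDerivWithinAt (x i) (xd i t) (Set.Ici (-τ)) t)
    (hcont : ∀ i, ContinuousOn (xd i) (Set.Ici (-τ)))
    (hode : ∀ t > (0 : ℝ), ∀ i, xd i t =
      ∑ j ∈ Finset.univ.erase i, ψ i j • (x j (t - τ) + (lam * τ) • xd j (t - τ) - x i t))
    (T0 : ℝ) (hT0 : 0 < T0) (I J : Fin N)
    (hIJ : ∀ t ≥ T0, maxDiscord x t = ‖x I t - x J t‖) :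
    IntegrableOn (fun s => (maxDiscord x s) ^ 2) (Set.Ioi T0) volume := by
  obtain ⟨b, δ, hδ, hdecay⟩ := exists_norm_sub_le_mul_exp hN hτ (mul_nonneg hlam hτ.le) hlamτ
    hψpos hψstoch hderiv hcont hode
  have hxcont : ∀ i, ContinuousOn (x i) (Set.Ioi T0) := fun i t ht =>
    ((hderiv i t (Set.mem_Ici.2 (by linarith [Set.mem_Ioi.1 ht]))).continuousWithinAt).mono
      fun r hr => Set.mem_Ici.2 (by linarith [Set.mem_Ioi.1 hr])
  have hint : IntegrableOn (fun s => b ^ 2 * Real.exp (-(2 * δ) * s)) (Set.Ioi T0) volume :=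
    (integrableOn_exp_mul_Ioi (by linarith) T0).const_mul _
  have hpair : IntegrableOn (fun s => ‖x I s - x J s‖ ^ 2) (Set.Ioi T0) volume := by
    refine hint.mono' ((((hxcont I).sub (hxcont J)).norm.pow 2).aestronglyMeasurable
      measurableSet_Ioi) ((ae_restrict_iff' measurableSet_Ioi).2 (ae_of_all _ fun s hs => ?_))
    rw [Real.norm_of_nonneg (by positivity)]
    calc ‖x I s - x J s‖ ^ 2 ≤ (b * Real.exp (-δ * s)) ^ 2 := by
          gcongr
          exact hdecay s (hT0.trans hs).le I J
      _ = b ^ 2 * Real.exp (-(2 * δ) * s) := by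
          rw [mul_pow, ← Real.exp_nat_mul]
          congr 2
          push_cast
          ring
  refine hpair.congr_fun (fun s hs => ?_) measurableSet_Ioi
  simp only [hIJ s (Set.mem_Ioi.1 hs).le]
end

section
/- Let the weights ψ be symmetric (ψ_{ij} = ψ_{ji}) and bi-stochastic, and let x be a solution of the reaction-delay system. Then for any ε > 0, δ > 0 and all t > τ: Σ_{i=1}^N Φ^i(t−τ) · x_i(t) ≤ ((δ−1)/2) D(t−τ) + ((1+ε)τ/(2δ)) ∫_{t−τ}^t D(s−τ) ds + (λ²τ²/δ)(1+ε^{−1}) Σ_{i=1}^N ( |Φ^i(t−τ)|² + |Φ^i(t−2τ)|² ), where · denotes the Euclidean inner product on ℝ^d. -/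
open Finset
open scoped RealInnerProductSpace

/-- `Φ^i(t) = Σ_j ψ_{ij} (x_j(t) - x_i(t))`. -/
noncomputable def Phi {N d : ℕ} (ψ : Fin N → Fin N → ℝ)
    (x : Fin N → ℝ → EuclideanSpace ℝ (Fin d)) (i : Fin N) (t : ℝ) : EuclideanSpace ℝ (Fin d) :=
  ∑ j : Fin N, ψ i j • (x j t - x i t)

/-- `D(t) = Σ_i Σ_j ψ_{ij} |x_j(t) - x_i(t)|²`. -/
noncomputable def Dquad {N d : ℕ} (ψ : Fin N → Fin N → ℝ)
    (x : Fin N → ℝ → EuclideanSpace ℝ (Fin d)) (t : ℝ) : ℝ :=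
  ∑ i : Fin N, ∑ j : Fin N, ψ i j * ‖x j t - x i t‖ ^ 2

/-- Cauchy–Schwarz for the integral of a continuous vector-valued curve. -/
lemma norm_sq_intervalIntegral_le {E : Type*} [NormedAddCommGroup E] [NormedSpace ℝ E]
    {a b : ℝ} (hab : a < b) {f : ℝ → E} (hf : ContinuousOn f (Set.Icc a b)) :
    ‖∫ s in a..b, f s‖ ^ 2 ≤ (b - a) * ∫ s in a..b, ‖f s‖ ^ 2 := by
  have hint : IntervalIntegrable (fun s => ‖f s‖) MeasureTheory.volume a b :=
    hf.norm.intervalIntegrable_of_Icc hab.le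
  have hint2 : IntervalIntegrable (fun s => ‖f s‖ ^ 2) MeasureTheory.volume a b :=
    (hf.norm.pow 2).intervalIntegrable_of_Icc hab.le
  have hnorm : ‖∫ s in a..b, f s‖ ≤ ∫ s in a..b, ‖f s‖ :=
    intervalIntegral.norm_integral_le_integral_norm hab.le
  set F := ∫ s in a..b, ‖f s‖
  set G := ∫ s in a..b, ‖f s‖ ^ 2
  have hL : 0 < b - a := sub_pos.2 hab
  have hmono : (∫ s in a..b, 2 * (F / (b - a)) * ‖f s‖) ≤
      ∫ s in a..b, ((F / (b - a)) ^ 2 + ‖f s‖ ^ 2) :=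
    intervalIntegral.integral_mono_on hab.le (hint.const_mul _)
      (intervalIntegrable_const.add hint2) fun s _ => by
        nlinarith [sq_nonneg (F / (b - a) - ‖f s‖)]
  rw [intervalIntegral.integral_const_mul,
    intervalIntegral.integral_add intervalIntegrable_const hint2,
    intervalIntegral.integral_const, smul_eq_mul] at hmono
  have hmul := mul_le_mul_of_nonneg_left hmono hL.le
  have hleft : (b - a) * (2 * (F / (b - a)) * F) = 2 * F ^ 2 := by field_simp
  have hright : (b - a) * ((b - a) * (F / (b - a)) ^ 2 + G) = F ^ 2 + (b - a) * G := by
    field_simp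
  have hsq : ‖∫ s in a..b, f s‖ ^ 2 ≤ F ^ 2 := pow_le_pow_left₀ (norm_nonneg _) hnorm 2
  linarith

/-- Young's inequality for the square of the norm of a sum. -/
lemma norm_add_sq_le_young {E : Type*} [NormedAddCommGroup E]
    {ε : ℝ} (hε : 0 < ε) (a b : E) :
    ‖a + b‖ ^ 2 ≤ (1 + ε) * ‖a‖ ^ 2 + (1 + ε⁻¹) * ‖b‖ ^ 2 := by
  have htri : ‖a + b‖ ^ 2 ≤ (‖a‖ + ‖b‖) ^ 2 :=
    pow_le_pow_left₀ (norm_nonneg _) (norm_add_le a b) 2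
  have hsq : 0 ≤ ε⁻¹ * (ε * ‖a‖ - ‖b‖) ^ 2 := by positivity
  have hexp : ε⁻¹ * (ε * ‖a‖ - ‖b‖) ^ 2 =
      ε * ‖a‖ ^ 2 - 2 * (‖a‖ * ‖b‖) + ε⁻¹ * ‖b‖ ^ 2 := by
    field_simp
    ring
  nlinarith

/-- Young's inequality for the inner product. -/
lemma inner_le_young {E : Type*} [NormedAddCommGroup E] [InnerProductSpace ℝ E]
    {δ : ℝ} (hδ : 0 < δ) (a b : E) :
    ⟪a, b⟫ ≤ δ / 2 * ‖a‖ ^ 2 + 1 / (2 * δ) * ‖b‖ ^ 2 := by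
  have hcs := real_inner_le_norm a b
  have hsq : 0 ≤ 1 / (2 * δ) * (δ * ‖a‖ - ‖b‖) ^ 2 := by positivity
  have hexp : 1 / (2 * δ) * (δ * ‖a‖ - ‖b‖) ^ 2 =
      δ / 2 * ‖a‖ ^ 2 - ‖a‖ * ‖b‖ + 1 / (2 * δ) * ‖b‖ ^ 2 := by
    field_simp
    ring
  linarith

section

variable {N d : ℕ} {ψ : Fin N → Fin N → ℝ} {x : Fin N → ℝ → EuclideanSpace ℝ (Fin d)}

lemma norm_Phi_sq_le (hψnonneg : ∀ i j, 0 ≤ ψ i j) (hψstoch : ∀ i, ∑ j, ψ i j = 1)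
    (i : Fin N) (t : ℝ) :
    ‖Phi ψ x i t‖ ^ 2 ≤ ∑ j, ψ i j * ‖x j t - x i t‖ ^ 2 := by
  have hconv : ConvexOn ℝ Set.univ fun v : EuclideanSpace ℝ (Fin d) => ‖v‖ ^ 2 :=
    convexOn_univ_norm.pow (fun _ _ => norm_nonneg _) 2
  exact hconv.map_sum_le (fun j _ => hψnonneg i j) (hψstoch i) fun _ _ => Set.mem_univ _

lemma sum_norm_Phi_sq_le_Dquad (hψnonneg : ∀ i j, 0 ≤ ψ i j)
    (hψstoch : ∀ i, ∑ j, ψ i j = 1) (t : ℝ) :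
    ∑ i, ‖Phi ψ x i t‖ ^ 2 ≤ Dquad ψ x t :=
  Finset.sum_le_sum fun i _ => norm_Phi_sq_le hψnonneg hψstoch i t

lemma sum_inner_Phi_self (hψsymm : ∀ i j, ψ i j = ψ j i) (t : ℝ) :
    ∑ i, ⟪Phi ψ x i t, x i t⟫ = -(1 / 2) * Dquad ψ x t := by
  have hexpand : ∑ i, ⟪Phi ψ x i t, x i t⟫ =
      ∑ i, ∑ j, ψ i j * ⟪x j t - x i t, x i t⟫ := by
    simp only [Phi, sum_inner, real_inner_smul_left]
  have hswap : ∑ i, ⟪Phi ψ x i t, x i t⟫ =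
      ∑ i, ∑ j, ψ i j * ⟪x i t - x j t, x j t⟫ := by
    rw [hexpand, Finset.sum_comm]
    exact Finset.sum_congr rfl fun i _ => Finset.sum_congr rfl fun j _ => by rw [hψsymm]
  have hD : ∑ i, ∑ j, ψ i j * ⟪x j t - x i t, x i t⟫ +
      ∑ i, ∑ j, ψ i j * ⟪x i t - x j t, x j t⟫ = -Dquad ψ x t := by
    simp only [Dquad, ← Finset.sum_add_distrib, ← Finset.sum_neg_distrib]
    refine Finset.sum_congr rfl fun i _ => Finset.sum_congr rfl fun j _ => ?_
    rw [← real_inner_self_eq_norm_sq]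
    simp only [inner_sub_left, inner_sub_right, real_inner_comm (x i t) (x j t)]
    ring
  linarith

lemma continuousOn_Phi {s : Set ℝ} (hx : ∀ i, ContinuousOn (x i) s) (i : Fin N) :
    ContinuousOn (Phi ψ x i) s :=
  continuousOn_finsetSum _ fun j _ => ((hx j).sub (hx i)).const_smul (ψ i j)

lemma continuousOn_Dquad {s : Set ℝ} (hx : ∀ i, ContinuousOn (x i) s) :
    ContinuousOn (Dquad ψ x) s :=
  continuousOn_finsetSum _ fun i _ => continuousOn_finsetSum _ fun j _ =>
    (((hx j).sub (hx i)).norm.pow 2).const_smul (ψ i j)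

lemma hasDerivAt_Phi {xd : Fin N → ℝ → EuclideanSpace ℝ (Fin d)} {t : ℝ}
    (hx : ∀ i, HasDerivAt (x i) (xd i t) t) (i : Fin N) :
    HasDerivAt (Phi ψ x i) (Phi ψ xd i t) t :=
  HasDerivAt.fun_sum fun j _ => ((hx j).sub (hx i)).const_smul (ψ i j)

lemma reaction_delay_displacement {xd : Fin N → ℝ → EuclideanSpace ℝ (Fin d)} {τ lam : ℝ}
    (hτ : 0 < τ)
    (hderiv : ∀ i, ∀ t ∈ Set.Ici (-τ), HasDerivWithinAt (x i) (xd i t) (Set.Ici (-τ)) t)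
    (hcont : ∀ i, ContinuousOn (xd i) (Set.Ici (-τ)))
    (hode : ∀ t > (0 : ℝ), ∀ i, xd i t =
      ∑ j : Fin N, ψ i j •
        (x j (t - τ) + (lam * τ) • xd j (t - τ) - x i (t - τ) - (lam * τ) • xd i (t - τ)))
    {t : ℝ} (ht : τ < t) (i : Fin N) :
    x i t - x i (t - τ) = (∫ s in (t - τ)..t, Phi ψ x i (s - τ)) +
      (lam * τ) • (Phi ψ x i (t - τ) - Phi ψ x i (t - 2 * τ)) := by
  have hd : ∀ j, ∀ s > -τ, HasDerivAt (x j) (xd j s) s := fun j s hs =>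
    (hderiv j s (Set.mem_Ici.2 hs.le)).hasDerivAt (Ici_mem_nhds hs)
  have hle : t - τ ≤ t := by linarith
  have hmaps : Set.MapsTo (fun s => s - τ) (Set.Icc (t - τ) t) (Set.Ici (-τ)) := fun s hs => by
    have := hs.1
    simp only [Set.mem_Ici]
    linarith
  have hshift : ContinuousOn (fun s : ℝ => s - τ) (Set.Icc (t - τ) t) := by fun_prop
  have hxc : ∀ j, ContinuousOn (x j) (Set.Ici (-τ)) := fun j s hs =>
    (hderiv j s hs).continuousWithinAt
  have hintΦ : IntervalIntegrable (fun s => Phi ψ x i (s - τ)) MeasureTheory.volume (t - τ) t :=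
    ((continuousOn_Phi hxc i).comp hshift hmaps).intervalIntegrable_of_Icc hle
  have hintΦd : IntervalIntegrable (fun s => Phi ψ xd i (s - τ)) MeasureTheory.volume (t - τ) t :=
    ((continuousOn_Phi hcont i).comp hshift hmaps).intervalIntegrable_of_Icc hle
  have hrhs : ∀ s ∈ Set.uIcc (t - τ) t, HasDerivAt (fun r => x i r - (lam * τ) • Phi ψ x i (r - τ))
      (Phi ψ x i (s - τ)) s := fun s hs => by
    rw [Set.uIcc_of_le hle] at hs
    have hs1 := hs.1
    have hP : HasDerivAt (fun r => Phi ψ x i (r - τ)) (Phi ψ xd i (s - τ)) s :=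
      (hasDerivAt_Phi (fun j => hd j (s - τ) (by linarith)) i).comp_sub_const s τ
    refine ((hd i s (by linarith)).sub (hP.const_smul (lam * τ))).congr_deriv ?_
    rw [hode s (by linarith) i, sub_eq_iff_eq_add, Phi, Phi, Finset.smul_sum,
      ← Finset.sum_add_distrib]
    exact Finset.sum_congr rfl fun j _ => by module
  rw [intervalIntegral.integral_eq_sub_of_hasDerivAt hrhs hintΦ,
    show t - τ - τ = t - 2 * τ by ring]
  module

end

/-- **Key estimate for the reaction-type delay system** (Lemma 5.1 of the paper). -/
theorem reaction_delay_key_estimate {N d : ℕ} (hN : 2 ≤ N) (hd : 1 ≤ d)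
    (τ lam : ℝ) (hτ : 0 < τ) (hlam : 0 ≤ lam)
    (ψ : Fin N → Fin N → ℝ)
    (hψsymm : ∀ i j : Fin N, ψ i j = ψ j i)
    (hψnonneg : ∀ i j : Fin N, 0 ≤ ψ i j)
    (hψstoch : ∀ i : Fin N, ∑ j : Fin N, ψ i j = 1)
    (x xd : Fin N → ℝ → EuclideanSpace ℝ (Fin d))
    (hderiv : ∀ i, ∀ t ∈ Set.Ici (-τ), HasDerivWithinAt (x i) (xd i t) (Set.Ici (-τ)) t)
    (hcont : ∀ i, ContinuousOn (xd i) (Set.Ici (-τ)))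
    (hode : ∀ t > (0 : ℝ), ∀ i, xd i t =
      ∑ j : Fin N, ψ i j •
        (x j (t - τ) + (lam * τ) • xd j (t - τ) - x i (t - τ) - (lam * τ) • xd i (t - τ))) :
    ∀ ε > (0 : ℝ), ∀ δ > (0 : ℝ), ∀ t > τ,
      ∑ i : Fin N, ⟪Phi ψ x i (t - τ), x i t⟫ ≤
        ((δ - 1) / 2) * Dquad ψ x (t - τ) +
          ((1 + ε) * τ / (2 * δ)) * (∫ s in (t - τ)..t, Dquad ψ x (s - τ)) +
          (lam ^ 2 * τ ^ 2 / δ) * (1 + ε⁻¹) *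
            ∑ i : Fin N, (‖Phi ψ x i (t - τ)‖ ^ 2 + ‖Phi ψ x i (t - 2 * τ)‖ ^ 2) := by
  intro ε hε δ hδ t ht
  have hxc : ∀ j, ContinuousOn (x j) (Set.Ici (-τ)) := fun j s hs =>
    (hderiv j s hs).continuousWithinAt
  have hlt : t - τ < t := by linarith
  have hmaps : Set.MapsTo (fun s => s - τ) (Set.Icc (t - τ) t) (Set.Ici (-τ)) := fun s hs => by
    have := hs.1
    simp only [Set.mem_Ici]
    linarith
  have hshift : ContinuousOn (fun s : ℝ => s - τ) (Set.Icc (t - τ) t) := by fun_prop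
  have hΦc : ∀ i, ContinuousOn (fun s => Phi ψ x i (s - τ)) (Set.Icc (t - τ) t) := fun i =>
    (continuousOn_Phi hxc i).comp hshift hmaps
  have hΦint : ∀ i, IntervalIntegrable (fun s => ‖Phi ψ x i (s - τ)‖ ^ 2)
      MeasureTheory.volume (t - τ) t := fun i =>
    ((hΦc i).norm.pow 2).intervalIntegrable_of_Icc hlt.le
  have hDint : IntervalIntegrable (fun s => Dquad ψ x (s - τ)) MeasureTheory.volume (t - τ) t :=
    ((continuousOn_Dquad hxc).comp hshift hmaps).intervalIntegrable_of_Icc hlt.le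
  have hdrift : ∑ i, ‖∫ s in (t - τ)..t, Phi ψ x i (s - τ)‖ ^ 2 ≤
      τ * ∫ s in (t - τ)..t, Dquad ψ x (s - τ) := calc
    _ ≤ ∑ i, τ * ∫ s in (t - τ)..t, ‖Phi ψ x i (s - τ)‖ ^ 2 :=
      Finset.sum_le_sum fun i _ =>
        (norm_sq_intervalIntegral_le hlt (hΦc i)).trans_eq (by rw [sub_sub_cancel])
    _ = τ * ∫ s in (t - τ)..t, ∑ i, ‖Phi ψ x i (s - τ)‖ ^ 2 := by
      rw [intervalIntegral.integral_finsetSum fun i _ => hΦint i, Finset.mul_sum]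
    _ ≤ _ := by
      refine mul_le_mul_of_nonneg_left (intervalIntegral.integral_mono_on hlt.le ?_ hDint
        fun s _ => sum_norm_Phi_sq_le_Dquad hψnonneg hψstoch _) hτ.le
      exact (continuousOn_finsetSum _ fun i _ =>
        (hΦc i).norm.pow 2).intervalIntegrable_of_Icc hlt.le
  have hdisp : ∀ i, ‖x i t - x i (t - τ)‖ ^ 2 ≤
      (1 + ε) * ‖∫ s in (t - τ)..t, Phi ψ x i (s - τ)‖ ^ 2 +
      (1 + ε⁻¹) * (lam ^ 2 * τ ^ 2 *
        (2 * (‖Phi ψ x i (t - τ)‖ ^ 2 + ‖Phi ψ x i (t - 2 * τ)‖ ^ 2))) := fun i => by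
    rw [reaction_delay_displacement hτ hderiv hcont hode ht i]
    refine (norm_add_sq_le_young hε _ _).trans (add_le_add_right
      (mul_le_mul_of_nonneg_left ?_ (by positivity)) _)
    rw [norm_smul, mul_pow, Real.norm_eq_abs, sq_abs, mul_pow]
    refine mul_le_mul_of_nonneg_left ?_ (by positivity)
    have := parallelogram_law_with_norm ℝ (Phi ψ x i (t - τ)) (Phi ψ x i (t - 2 * τ))
    nlinarith [sq_nonneg ‖Phi ψ x i (t - τ) + Phi ψ x i (t - 2 * τ)‖]
  have hdispsum : ∑ i, ‖x i t - x i (t - τ)‖ ^ 2 ≤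
      (1 + ε) * (τ * ∫ s in (t - τ)..t, Dquad ψ x (s - τ)) +
      (1 + ε⁻¹) * (lam ^ 2 * τ ^ 2 *
        (2 * ∑ i, (‖Phi ψ x i (t - τ)‖ ^ 2 + ‖Phi ψ x i (t - 2 * τ)‖ ^ 2))) := by
    refine (Finset.sum_le_sum fun i _ => hdisp i).trans ?_
    simp only [Finset.sum_add_distrib (f := fun i => (1 + ε) * _), ← Finset.mul_sum]
    exact add_le_add_left (mul_le_mul_of_nonneg_left hdrift (by positivity)) _
  calc ∑ i, ⟪Phi ψ x i (t - τ), x i t⟫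
      = ∑ i, ⟪Phi ψ x i (t - τ), x i (t - τ)⟫ +
        ∑ i, ⟪Phi ψ x i (t - τ), x i t - x i (t - τ)⟫ := by
        rw [← Finset.sum_add_distrib]
        exact Finset.sum_congr rfl fun i _ => by rw [← inner_add_right, add_sub_cancel]
    _ ≤ -(1 / 2) * Dquad ψ x (t - τ) + (δ / 2 * Dquad ψ x (t - τ) +
        1 / (2 * δ) * ((1 + ε) * (τ * ∫ s in (t - τ)..t, Dquad ψ x (s - τ)) +
          (1 + ε⁻¹) * (lam ^ 2 * τ ^ 2 *
            (2 * ∑ i, (‖Phi ψ x i (t - τ)‖ ^ 2 + ‖Phi ψ x i (t - 2 * τ)‖ ^ 2))))) := by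
        rw [sum_inner_Phi_self hψsymm]
        refine add_le_add_right ((Finset.sum_le_sum fun i _ => inner_le_young hδ _ _).trans ?_) _
        rw [Finset.sum_add_distrib, ← Finset.mul_sum, ← Finset.mul_sum]
        exact add_le_add
          (mul_le_mul_of_nonneg_left (sum_norm_Phi_sq_le_Dquad hψnonneg hψstoch _) (by positivity))
          (mul_le_mul_of_nonneg_left hdispsum (by positivity))
    _ = _ := by
        field_simp
        ring
end

section
/- Let the weights ψ be row-stochastic and let x be a solution of the transmission-delay system. Then for every i ∈ {1,…,N}, the function t ↦ x_i(t) − λτ Ψ^i(t−τ) is differentiable at every t > 0 with derivative d/dt [ x_i(t) − λτ Ψ^i(t−τ) ] = Ψ^i(t−τ) − x_i(t), i.e., the derivative of this anticipation-corrected variable contains no delayed derivative terms. -/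
open Finset

/-- `Ψ^i(t) = Σ_{j ≠ i} ψ_{ij} x_j(t)`. -/
noncomputable def Psi {N d : ℕ} (ψ : Fin N → Fin N → ℝ)
    (x : Fin N → ℝ → EuclideanSpace ℝ (Fin d)) (i : Fin N) (t : ℝ) : EuclideanSpace ℝ (Fin d) :=
  ∑ j ∈ Finset.univ.erase i, ψ i j • x j t

/-- **The anticipation-corrected variable has a derivative free of delayed derivative terms:**
for the transmission-type delay system, `d/dt [x_i(t) - λτ Ψ^i(t-τ)] = Ψ^i(t-τ) - x_i(t)`. -/
theorem transmission_delay_corrected_variable_derivative {N d : ℕ} (hN : 2 ≤ N) (hd : 1 ≤ d)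
    (τ lam : ℝ) (hτ : 0 < τ) (hlam : 0 ≤ lam)
    (ψ : Fin N → Fin N → ℝ)
    (hψstoch : ∀ i : Fin N, ∑ j ∈ Finset.univ.erase i, ψ i j = 1)
    (x xd : Fin N → ℝ → EuclideanSpace ℝ (Fin d))
    (hderiv : ∀ i, ∀ t ∈ Set.Ici (-τ), HasDerivWithinAt (x i) (xd i t) (Set.Ici (-τ)) t)
    (hcont : ∀ i, ContinuousOn (xd i) (Set.Ici (-τ)))
    (hode : ∀ t > (0 : ℝ), ∀ i, xd i t =
      ∑ j ∈ Finset.univ.erase i, ψ i j • (x j (t - τ) + (lam * τ) • xd j (t - τ) - x i t)) :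
    ∀ i : Fin N, ∀ t > (0 : ℝ),
      HasDerivAt (fun s => x i s - (lam * τ) • Psi ψ x i (s - τ))
        (Psi ψ x i (t - τ) - x i t) t := by
  intro i t ht
  have hx : ∀ j, ∀ s > -τ, HasDerivAt (x j) (xd j s) s := fun j s hs =>
    (hderiv j s (Set.mem_Ici.2 hs.le)).hasDerivAt (Ici_mem_nhds hs)
  have hdelay : ∀ j, HasDerivAt (fun s => x j (s - τ)) (xd j (t - τ)) t := fun j =>
    (hx j (t - τ) (by linarith)).comp_sub_const t τ
  have hPsi : HasDerivAt (fun s => Psi ψ x i (s - τ)) (Psi ψ xd i (t - τ)) t :=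
    HasDerivAt.fun_sum fun j _ => (hdelay j).const_smul (ψ i j)
  have hxd : xd i t = Psi ψ x i (t - τ) + (lam * τ) • Psi ψ xd i (t - τ) - x i t := by
    simp only [hode t ht i, Psi, smul_sub, smul_add, Finset.sum_sub_distrib,
      Finset.sum_add_distrib, ← Finset.sum_smul, hψstoch, one_smul, Finset.smul_sum,
      smul_comm (lam * τ)]
  have h := (hx i t (by linarith)).sub (hPsi.const_smul (lam * τ))
  rw [hxd] at h
  exact h.congr_deriv (by abel)
end

section
/- Let the weights ψ be row-stochastic with ψ_{ii} = 0 for all i, let P denote the N×N matrix (ψ_{ij}), and let x be a solution of the transmission-delay system. Then for every integer k ≥ 0, every i ∈ {1,…,N}, and every t ∈ (0, τ): x_i'(t + kτ) = (1−λτ) Σ_{m=1}^{k} (λτ)^{k−m} (P^{k+1−m} x(t+(m−1)τ))_i + (λτ)^k (P^{k+1} x(t−τ))_i + (λτ)^{k+1} (P^{k+1} x'(t−τ))_i − x_i(t + kτ), where (P^r v)_i denotes the i-th component of the matrix power P^r applied to the vector (v_1,…,v_N) of ℝ^d-valued entries, and x'(t−τ) = (x_1'(t−τ),…,x_N'(t−τ)).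 -/
open Finset

/-- The action of the `r`-th power of the weight matrix `P = (ψ_{ij})` on a vector
`v = (v_1, …, v_N)` with entries in `ℝ^d`: `(P^r v)_i = Σ_j (P^r)_{ij} v_j`. -/
noncomputable def matPowAct {N d : ℕ} (ψ : Fin N → Fin N → ℝ) (r : ℕ)
    (v : Fin N → EuclideanSpace ℝ (Fin d)) (i : Fin N) : EuclideanSpace ℝ (Fin d) :=
  ∑ j : Fin N, ((Matrix.of ψ) ^ r) i j • v j

theorem matPowAct_one {N d : ℕ} (ψ : Fin N → Fin N → ℝ)
    (v : Fin N → EuclideanSpace ℝ (Fin d)) (i : Fin N) :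
    matPowAct ψ 1 v i = ∑ j, ψ i j • v j := by
  simp [matPowAct]

theorem matPowAct_add {N d : ℕ} (ψ : Fin N → Fin N → ℝ) (r : ℕ)
    (v w : Fin N → EuclideanSpace ℝ (Fin d)) (i : Fin N) :
    matPowAct ψ r (fun j => v j + w j) i = matPowAct ψ r v i + matPowAct ψ r w i := by
  simp [matPowAct, smul_add, Finset.sum_add_distrib]

theorem matPowAct_sub {N d : ℕ} (ψ : Fin N → Fin N → ℝ) (r : ℕ)
    (v w : Fin N → EuclideanSpace ℝ (Fin d)) (i : Fin N) :
    matPowAct ψ r (fun j => v j - w j) i = matPowAct ψ r v i - matPowAct ψ r w i := by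
  simp [matPowAct, smul_sub, Finset.sum_sub_distrib]

theorem matPowAct_smul {N d : ℕ} (ψ : Fin N → Fin N → ℝ) (r : ℕ) (c : ℝ)
    (v : Fin N → EuclideanSpace ℝ (Fin d)) (i : Fin N) :
    matPowAct ψ r (fun j => c • v j) i = c • matPowAct ψ r v i := by
  simp only [matPowAct, Finset.smul_sum]
  exact Finset.sum_congr rfl fun j _ => smul_comm _ _ _

theorem matPowAct_sum {N d : ℕ} {ι : Type*} (ψ : Fin N → Fin N → ℝ) (r : ℕ) (s : Finset ι)
    (v : ι → Fin N → EuclideanSpace ℝ (Fin d)) (i : Fin N) :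
    matPowAct ψ r (fun j => ∑ m ∈ s, v m j) i = ∑ m ∈ s, matPowAct ψ r (v m) i := by
  simp only [matPowAct, Finset.smul_sum]
  exact Finset.sum_comm

/-- Applying `P^r` and then `P` is the same as applying `P^(r+1)`. -/
theorem matPowAct_one_matPowAct {N d : ℕ} (ψ : Fin N → Fin N → ℝ) (r : ℕ)
    (v : Fin N → EuclideanSpace ℝ (Fin d)) (i : Fin N) :
    matPowAct ψ 1 (fun j => matPowAct ψ r v j) i = matPowAct ψ (r + 1) v i := by
  rw [matPowAct_one]
  simp only [matPowAct, Finset.smul_sum, pow_succ', Matrix.mul_apply, Finset.sum_smul, smul_smul,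
    Matrix.of_apply]
  exact Finset.sum_comm

/-- For row-stochastic weights with zero diagonal, the interaction sum is `P v - y`. -/
theorem sum_erase_smul_sub_eq {N d : ℕ} (ψ : Fin N → Fin N → ℝ)
    (hψdiag : ∀ i : Fin N, ψ i i = 0)
    (hψstoch : ∀ i : Fin N, ∑ j ∈ Finset.univ.erase i, ψ i j = 1)
    (v : Fin N → EuclideanSpace ℝ (Fin d)) (y : EuclideanSpace ℝ (Fin d)) (i : Fin N) :
    ∑ j ∈ Finset.univ.erase i, ψ i j • (v j - y) = matPowAct ψ 1 v i - y := by
  rw [matPowAct_one,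
    ← Finset.sum_erase (f := fun j => ψ i j • v j) (a := i) _ (by simp [hψdiag])]
  simp only [smul_sub, Finset.sum_sub_distrib, ← Finset.sum_smul, hψstoch, one_smul]

/-- **Explicit representation of the derivative for the transmission-type delay system**
(formula (4.4) of the paper), obtained by induction over the delay intervals. -/
theorem transmission_delay_derivative_representation {N d : ℕ} (hN : 2 ≤ N) (hd : 1 ≤ d)
    (τ lam : ℝ) (hτ : 0 < τ) (hlam : 0 ≤ lam)
    (ψ : Fin N → Fin N → ℝ)
    (hψdiag : ∀ i : Fin N, ψ i i = 0)
    (hψstoch : ∀ i : Fin N, ∑ j ∈ Finset.univ.erase i, ψ i j = 1)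
    (x xd : Fin N → ℝ → EuclideanSpace ℝ (Fin d))
    (hderiv : ∀ i, ∀ t ∈ Set.Ici (-τ), HasDerivWithinAt (x i) (xd i t) (Set.Ici (-τ)) t)
    (hcont : ∀ i, ContinuousOn (xd i) (Set.Ici (-τ)))
    (hode : ∀ t > (0 : ℝ), ∀ i, xd i t =
      ∑ j ∈ Finset.univ.erase i, ψ i j • (x j (t - τ) + (lam * τ) • xd j (t - τ) - x i t)) :
    ∀ k : ℕ, ∀ i : Fin N, ∀ t ∈ Set.Ioo (0 : ℝ) τ,
      xd i (t + (k : ℝ) * τ) =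
        (1 - lam * τ) •
            (∑ m ∈ Finset.Icc 1 k, (lam * τ) ^ (k - m) •
              matPowAct ψ (k + 1 - m) (fun j => x j (t + ((m : ℝ) - 1) * τ)) i) +
          (lam * τ) ^ k • matPowAct ψ (k + 1) (fun j => x j (t - τ)) i +
          (lam * τ) ^ (k + 1) • matPowAct ψ (k + 1) (fun j => xd j (t - τ)) i -
          x i (t + (k : ℝ) * τ) := by
  have hstep : ∀ t > (0 : ℝ), ∀ i, xd i t =
      matPowAct ψ 1 (fun j => x j (t - τ)) i +
        (lam * τ) • matPowAct ψ 1 (fun j => xd j (t - τ)) i - x i t := by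
    intro t ht i
    rw [hode t ht i, sum_erase_smul_sub_eq ψ hψdiag hψstoch
      (fun j => x j (t - τ) + (lam * τ) • xd j (t - τ)), matPowAct_add, matPowAct_smul]
  intro k
  induction k with
  | zero =>
    intro i t ht
    simpa using hstep t ht.1 i
  | succ k ih =>
    intro i t ht
    have hpos : 0 < t + ((k + 1 : ℕ) : ℝ) * τ := by
      have := ht.1
      positivity
    have hshift : t + ((k + 1 : ℕ) : ℝ) * τ - τ = t + (k : ℝ) * τ := by
      push_cast
      ring
    have hlast : t + (((k + 1 : ℕ) : ℝ) - 1) * τ = t + (k : ℝ) * τ := by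
      push_cast
      ring
    have hsum : ∑ m ∈ Finset.Icc 1 k, (lam * τ) ^ (k + 1 - m) •
          matPowAct ψ (k + 1 + 1 - m) (fun j => x j (t + ((m : ℝ) - 1) * τ)) i =
        (lam * τ) • ∑ m ∈ Finset.Icc 1 k, (lam * τ) ^ (k - m) •
          matPowAct ψ (k + 1 - m + 1) (fun j => x j (t + ((m : ℝ) - 1) * τ)) i := by
      rw [Finset.smul_sum]
      refine Finset.sum_congr rfl fun m hm => ?_
      have hmk := (Finset.mem_Icc.mp hm).2
      rw [smul_smul, ← pow_succ', Nat.sub_add_comm hmk,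
        show k + 1 + 1 - m = k - m + 1 + 1 by omega]
    rw [hstep _ hpos i, hshift]
    simp only [fun j => ih j t ht]
    simp only [matPowAct_sub, matPowAct_add, matPowAct_smul, matPowAct_sum,
      matPowAct_one_matPowAct]
    rw [Finset.sum_Icc_succ_top (by omega), hsum, hlast, Nat.sub_self,
      Nat.add_sub_cancel_left, pow_zero, one_smul]
    module
end
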